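/- arXiv:math/0403330 — 2 statements merged into one kernel-verified Lean document; each statement's English description precedes it below -/
import Mathlib

section
/- Fix a Jordan frame (c₁,…,c_r) of J and, for integers p,q ≥ 0 with p+q ≤ r, set e_{p,q} = Σ_{j=1}^{p} c_j − Σ_{j=p+1}^{p+q} c_j. Then J is the disjoint union of the orbits L·e_{p,q} over all pairs (p,q) with 0 ≤ p, q and p+q ≤ r. -/
open scoped BigOperators Classical

/-- Bare data of a (real) Jordan algebra: a bilinear product and a unit element. -/
structure JordanData (J : Type) [AddCommGroup J] [Module ℝ J] where
  mul : J →ₗ[ℝ] J →ₗ[ℝ] J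
  e : J

namespace JordanData

variable {J : Type} [AddCommGroup J] [Module ℝ J] (A : JordanData J)

/-- `c` is an idempotent. -/
def IsIdem (c : J) : Prop := A.mul c c = c

/-- `c` is a primitive idempotent: a nonzero idempotent which dominates only `0` and itself. -/
def IsPrimitive (c : J) : Prop :=
  A.IsIdem c ∧ c ≠ 0 ∧ ∀ d : J, A.IsIdem d → A.mul c d = d → d = 0 ∨ d = c

/-- A Jordan frame: a complete system of pairwise orthogonal primitive idempotents. -/
def IsFrame {m : ℕ} (c : Fin m → J) : Prop :=
  (∀ j, A.IsPrimitive (c j)) ∧ (∀ i j, i ≠ j → A.mul (c i) (c j) = 0) ∧ ∑ j, c j = A.e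

end JordanData

/-- A simple Euclidean Jordan algebra of rank `rank`, together with its trace `tr`
and determinant `jdet` (characterized by their values on spectral decompositions). -/
structure EJA (J : Type) [NormedAddCommGroup J] [NormedSpace ℝ J] [FiniteDimensional ℝ J]
    extends JordanData J where
  comm : ∀ x y : J, mul x y = mul y x
  unit_mul : ∀ x : J, mul e x = x
  jordan : ∀ x y : J, mul (mul x x) (mul x y) = mul x (mul (mul x x) y)
  tr : J →ₗ[ℝ] ℝ
  tr_posdef : ∀ x : J, x ≠ 0 → 0 < tr (mul x x)
  simple : ∀ I : Submodule ℝ J, (∀ x ∈ I, ∀ y : J, mul y x ∈ I) → I = ⊥ ∨ I = ⊤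
  rank : ℕ
  spectral : ∀ x : J, ∃ (c : Fin rank → J) (lam : Fin rank → ℝ),
    toJordanData.IsFrame c ∧ x = ∑ j, lam j • c j
  tr_prim : ∀ c : J, toJordanData.IsPrimitive c → tr c = 1
  jdet : J → ℝ
  jdet_frame : ∀ (c : Fin rank → J) (lam : Fin rank → ℝ),
    toJordanData.IsFrame c → jdet (∑ j, lam j • c j) = ∏ j, lam j

namespace EJA

variable {J : Type} [NormedAddCommGroup J] [NormedSpace ℝ J] [FiniteDimensional ℝ J]

def IsIdem (A : EJA J) (c : J) : Prop := A.toJordanData.IsIdem c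

def IsPrimitive (A : EJA J) (c : J) : Prop := A.toJordanData.IsPrimitive c

def IsFrame (A : EJA J) {m : ℕ} (c : Fin m → J) : Prop := A.toJordanData.IsFrame c

/-- `x` has rank `k`: in a spectral decomposition of `x`, exactly `k` eigenvalues are nonzero. -/
def HasRank (A : EJA J) (x : J) (k : ℕ) : Prop :=
  ∃ (c : Fin A.rank → J) (lam : Fin A.rank → ℝ), A.IsFrame c ∧
    x = ∑ j, lam j • c j ∧ (Finset.univ.filter fun j => lam j ≠ 0).card = k

/-- The symmetric cone `Ω`: the interior of the set of squares. -/
def cone (A : EJA J) : Set J := interior {x : J | ∃ y : J, x = A.mul y y}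

/-- The Peirce space `J(c,t)`, i.e. the `t`-eigenspace of the multiplication operator `L(c)`. -/
def peirce (A : EJA J) (c : J) (t : ℝ) : Submodule ℝ J :=
  LinearMap.ker (A.mul c - t • (LinearMap.id : J →ₗ[ℝ] J))

/-- The symmetric cone of the Jordan subalgebra `J(c,t)` (`t = 1` or `t = 0`):
the relative interior, within `J(c,t)`, of the set of squares of elements of `J(c,t)`. -/
def subCone (A : EJA J) (c : J) (t : ℝ) : Set J :=
  {x : J | x ∈ A.peirce c t ∧ ∃ U : Set J, IsOpen U ∧ x ∈ U ∧
    ∀ y ∈ U, y ∈ A.peirce c t → ∃ w ∈ A.peirce c t, y = A.mul w w}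

/-- Powers in the Jordan algebra, with `x ^ 0 = e`. -/
def pow (A : EJA J) (x : J) : ℕ → J
  | 0 => A.e
  | n + 1 => A.mul x (A.pow x n)

/-- `y` is the Jordan inverse of `x`: `y` lies in the subalgebra `ℝ[x]` and `x·y = e`. -/
def IsInverse (A : EJA J) (x y : J) : Prop :=
  y ∈ Submodule.span ℝ (Set.range (A.pow x)) ∧ A.mul x y = A.e

/-- The set of invertible linear maps preserving the symmetric cone. -/
def conePreserving (A : EJA J) : Set (J →L[ℝ] J)ˣ :=
  {g | (g : J →L[ℝ] J) '' A.cone = A.cone}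

theorem one_mem_conePreserving (A : EJA J) : 1 ∈ A.conePreserving := by
  show (↑(1 : (J →L[ℝ] J)ˣ) : J →L[ℝ] J) '' A.cone = A.cone
  simp

/-- The group `L`: the identity component of the group of linear transformations of `J`
preserving the symmetric cone `Ω`. -/
def Lgroup (A : EJA J) : Set (J →L[ℝ] J)ˣ :=
  {g | ∃ h : g ∈ A.conePreserving,
    (⟨g, h⟩ : A.conePreserving) ∈ connectedComponent ⟨1, A.one_mem_conePreserving⟩}

end EJA


open scoped BigOperators Classical
namespace EJA

variable {J : Type} [NormedAddCommGroup J] [NormedSpace ℝ J] [FiniteDimensional ℝ J]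

/-! ### Linearized Jordan identities -/

theorem lin1 (A : EJA J) (x z w : J) :
    (2:ℝ) • A.mul x (A.mul (A.mul x z) w) + A.mul z (A.mul (A.mul x x) w)
      = (2:ℝ) • A.mul (A.mul x z) (A.mul x w) + A.mul (A.mul x x) (A.mul z w) := by
  have h1 := A.jordan (x + z) w
  have h2 := A.jordan (x - z) w
  have h3 := A.jordan z w
  have hc := A.comm z x
  simp only [map_add, map_sub, LinearMap.add_apply, LinearMap.sub_apply, hc] at h1 h2 h3
  linear_combination (norm := module) (-1/2:ℝ) • h1 + (1/2:ℝ) • h2 + h3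

theorem lin2 (A : EJA J) (x y z w : J) :
    A.mul x (A.mul (A.mul y z) w) + A.mul y (A.mul (A.mul x z) w) + A.mul z (A.mul (A.mul x y) w)
      = A.mul (A.mul y z) (A.mul x w) + A.mul (A.mul x z) (A.mul y w)
        + A.mul (A.mul x y) (A.mul z w) := by
  have h1 := A.lin1 (x + y) z w
  have h2 := A.lin1 x z w
  have h3 := A.lin1 y z w
  have hc := A.comm y x
  simp only [map_add, LinearMap.add_apply, hc] at h1 h2 h3
  linear_combination (norm := module) (1/2:ℝ) • h1 - (1/2:ℝ) • h2 - (1/2:ℝ) • h3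

/-- The operator form of the linearized identity. -/
theorem lin3 (A : EJA J) (x y w z : J) :
    A.mul x (A.mul w (A.mul y z)) + A.mul y (A.mul w (A.mul x z)) + A.mul (A.mul (A.mul x y) w) z
      = A.mul x (A.mul (A.mul y w) z) + A.mul y (A.mul (A.mul x w) z)
        + A.mul w (A.mul (A.mul x y) z) := by
  have h1 := A.lin2 x y z w
  have h2 := A.lin2 x y w z
  rw [A.comm (A.mul y z) w, A.comm (A.mul x z) w, A.comm z (A.mul (A.mul x y) w)] at h1
  rw [A.comm (A.mul y z) (A.mul x w), A.comm (A.mul x z) (A.mul y w), A.comm z w] at h1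
  linear_combination (norm := module) h1 - h2

/-- Inner derivations. -/
theorem deriv_aux (A : EJA J) (x w y z : J) :
    A.mul x (A.mul w (A.mul y z)) - A.mul w (A.mul x (A.mul y z))
      = A.mul (A.mul x (A.mul w y) - A.mul w (A.mul x y)) z
        + A.mul y (A.mul x (A.mul w z) - A.mul w (A.mul x z)) := by
  have h1 := A.lin3 x y w z
  have h2 := A.lin3 w y x z
  rw [A.comm (A.mul x y) w, A.comm y w] at h1
  rw [A.comm (A.mul w y) x, A.comm y x, A.comm w x] at h2
  simp only [map_sub, LinearMap.sub_apply]
  linear_combination (norm := module) h1 - h2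

/-- If `c` is idempotent and `c d = 0` then `L(c)` and `L(d)` commute. -/
theorem comm_of_orth (A : EJA J) {c d : J} (hc : A.mul c c = c) (hd : A.mul c d = 0) (w : J) :
    A.mul c (A.mul d w) = A.mul d (A.mul c w) := by
  have h := A.lin1 c d w
  simp only [hc, hd, map_zero, LinearMap.zero_apply, smul_zero, zero_add] at h
  exact h.symm

/-- If `c` is idempotent and `c d = d` then `L(c)` and `L(d)` commute. -/
theorem comm_of_one (A : EJA J) {c d : J} (hc : A.mul c c = c) (hd : A.mul c d = d) (w : J) :
    A.mul c (A.mul d w) = A.mul d (A.mul c w) := by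
  have h := A.lin1 c d w
  simp only [hc, hd] at h
  linear_combination (norm := module) h

theorem peirce_cubic (A : EJA J) {c : J} (hc : A.mul c c = c) (y : J) :
    (2:ℝ) • A.mul c (A.mul c (A.mul c y)) = (3:ℝ) • A.mul c (A.mul c y) - A.mul c y := by
  have h := A.lin3 c c c y
  simp only [hc] at h
  linear_combination (norm := module) h

theorem mul_e (A : EJA J) (x : J) : A.mul x A.e = x := by rw [A.comm, A.unit_mul]

theorem idem_compl (A : EJA J) {c : J} (hc : A.mul c c = c) :
    A.mul (A.e - c) (A.e - c) = A.e - c := by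
  simp only [map_sub, LinearMap.sub_apply, A.unit_mul, A.mul_e, hc]; abel

/-- products `J_1 J_0 = 0` -/
theorem mul_one_zero (A : EJA J) {c x y : J} (hc : A.mul c c = c) (hx : A.mul c x = x)
    (hy : A.mul c y = 0) : A.mul x y = 0 := by
  have h1 := A.comm_of_one hc hx y
  have h2 := A.comm_of_orth hc hy x
  rw [hy, map_zero, A.comm x y, h2, hx] at h1
  rw [A.comm, h1]

theorem mul_zero_zero (A : EJA J) {c x y : J} (hc : A.mul c c = c) (hx : A.mul c x = 0)
    (hy : A.mul c y = 0) : A.mul c (A.mul x y) = 0 := by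
  rw [A.comm_of_orth hc hx, hy, map_zero]

theorem mul_one_one (A : EJA J) {c x y : J} (hc : A.mul c c = c) (hx : A.mul c x = x)
    (hy : A.mul c y = y) : A.mul c (A.mul x y) = A.mul x y := by
  rw [A.comm_of_one hc hx, hy]

theorem mul_half_half (A : EJA J) {c y : J} (hc : A.mul c c = c) (hy : A.mul c y = (1/2:ℝ) • y) :
    A.mul c (A.mul c (A.mul y y)) = A.mul c (A.mul y y) := by
  have h := A.lin1 y c c
  rw [A.comm y c, hy, A.comm ((1/2:ℝ) • y) c, A.comm (A.mul y y) c, hc, A.comm (A.mul y y) c] at h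
  simp only [map_smul, hy, LinearMap.smul_apply] at h
  linear_combination (norm := module) h

/-! ### The trace form -/

/-- `τ(x) = Tr L(x)`. -/
noncomputable def tau (A : EJA J) : J →ₗ[ℝ] ℝ := (LinearMap.trace ℝ J) ∘ₗ A.mul

/-- The associative inner product. -/
noncomputable def ip (A : EJA J) (x y : J) : ℝ := A.tau (A.mul x y)

theorem ip_comm (A : EJA J) (x y : J) : A.ip x y = A.ip y x := by
  unfold ip; rw [A.comm]

theorem ip_add_left (A : EJA J) (x y z : J) : A.ip (x + y) z = A.ip x z + A.ip y z := by
  simp [ip]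
theorem ip_sub_left (A : EJA J) (x y z : J) : A.ip (x - y) z = A.ip x z - A.ip y z := by
  simp [ip]
theorem ip_smul_left (A : EJA J) (a : ℝ) (x z : J) : A.ip (a • x) z = a * A.ip x z := by
  simp [ip]
theorem ip_add_right (A : EJA J) (x y z : J) : A.ip z (x + y) = A.ip z x + A.ip z y := by
  simp [ip]
theorem ip_sub_right (A : EJA J) (x y z : J) : A.ip z (x - y) = A.ip z x - A.ip z y := by
  simp [ip]
theorem ip_smul_right (A : EJA J) (a : ℝ) (x z : J) : A.ip z (a • x) = a * A.ip z x := by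
  simp [ip]
theorem ip_zero_left (A : EJA J) (z : J) : A.ip 0 z = 0 := by simp [ip]
theorem ip_zero_right (A : EJA J) (z : J) : A.ip z 0 = 0 := by simp [ip]
theorem ip_neg_left (A : EJA J) (x z : J) : A.ip (-x) z = - A.ip x z := by simp [ip]
theorem ip_sum_left (A : EJA J) {ι : Type*} (s : Finset ι) (f : ι → J) (z : J) :
    A.ip (∑ i ∈ s, f i) z = ∑ i ∈ s, A.ip (f i) z := by
  simp [ip, map_sum, LinearMap.sum_apply]
theorem ip_sum_right (A : EJA J) {ι : Type*} (s : Finset ι) (f : ι → J) (z : J) :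
    A.ip z (∑ i ∈ s, f i) = ∑ i ∈ s, A.ip z (f i) := by
  simp [ip, map_sum]

theorem tau_deriv (A : EJA J) (x w y : J) :
    A.tau (A.mul x (A.mul w y)) = A.tau (A.mul w (A.mul x y)) := by
  have h : A.mul (A.mul x (A.mul w y) - A.mul w (A.mul x y))
      = (A.mul x * A.mul w) * A.mul y - A.mul w * (A.mul x * A.mul y)
        - (A.mul y * A.mul x * A.mul w - A.mul y * A.mul w * A.mul x) := by
    ext z
    have := A.deriv_aux x w y z
    simp only [LinearMap.sub_apply, Module.End.mul_apply, map_sub] at this ⊢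
    linear_combination (norm := module) -this
  have h2 : A.tau (A.mul x (A.mul w y) - A.mul w (A.mul x y)) = 0 := by
    unfold tau
    rw [LinearMap.comp_apply, h]
    simp only [map_sub]
    rw [LinearMap.trace_mul_comm ℝ (A.mul x * A.mul w) (A.mul y),
      ← mul_assoc (A.mul w), LinearMap.trace_mul_comm ℝ (A.mul w * A.mul x) (A.mul y)]
    simp only [mul_assoc]; ring
  rw [map_sub] at h2
  linarith

/-- `L(x)` is symmetric. -/
theorem ip_mul (A : EJA J) (x y z : J) : A.ip (A.mul x y) z = A.ip y (A.mul x z) := by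
  unfold ip
  rw [A.comm (A.mul x y) z, A.comm x y, A.tau_deriv z y x, A.comm z x]

/-- Peirce projections. -/
noncomputable def pr1 (A : EJA J) (c : J) : Module.End ℝ J := (2:ℝ) • (A.mul c * A.mul c) - A.mul c
noncomputable def prh (A : EJA J) (c : J) : Module.End ℝ J :=
  (4:ℝ) • A.mul c - (4:ℝ) • (A.mul c * A.mul c)

theorem pr1_idem (A : EJA J) {c : J} (hc : A.mul c c = c) :
    IsIdempotentElem (A.pr1 c) := by
  have h := A.peirce_cubic hc
  ext y
  have h1 := h y
  have h2 := h (A.mul c y)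
  simp only [pr1, Module.End.mul_apply, LinearMap.sub_apply, LinearMap.smul_apply, map_sub, map_smul]
  linear_combination (norm := module) (2:ℝ) • h2 + (1:ℝ) • h1

theorem prh_idem (A : EJA J) {c : J} (hc : A.mul c c = c) :
    IsIdempotentElem (A.prh c) := by
  have h := A.peirce_cubic hc
  ext y
  have h1 := h y
  have h2 := h (A.mul c y)
  simp only [prh, Module.End.mul_apply, LinearMap.sub_apply, LinearMap.smul_apply, map_sub, map_smul]
  linear_combination (norm := module) (8:ℝ) • h2 - (4:ℝ) • h1

theorem mul_eq_pr (A : EJA J) (c : J) : A.mul c = A.pr1 c + (1/2:ℝ) • A.prh c := by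
  simp only [pr1, prh]
  module

theorem trace_idem_nonneg {f : Module.End ℝ J} (hf : IsIdempotentElem f) :
    0 ≤ LinearMap.trace ℝ J f := by
  rw [LinearMap.IsProj.trace (LinearMap.IsIdempotentElem.isProj_range f hf)]
  positivity

theorem tau_idem_pos (A : EJA J) {c : J} (hc : A.mul c c = c) (h0 : c ≠ 0) : 0 < A.tau c := by
  have h1 := trace_idem_nonneg (A.pr1_idem hc)
  have h2 := trace_idem_nonneg (A.prh_idem hc)
  have h3 : LinearMap.trace ℝ J (A.pr1 c) ≠ 0 := by
    intro h
    rw [LinearMap.IsIdempotentElem.trace_eq_zero_iff (A.pr1_idem hc)] at h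
    have := congrArg (fun f => f c) h
    simp only [pr1, LinearMap.sub_apply, LinearMap.smul_apply, Module.End.mul_apply, hc,
      LinearMap.zero_apply] at this
    apply h0
    rw [← this]; module
  have : A.tau c = LinearMap.trace ℝ J (A.pr1 c) + (1/2) * LinearMap.trace ℝ J (A.prh c) := by
    unfold tau
    rw [LinearMap.comp_apply]
    conv_lhs => rw [A.mul_eq_pr c]
    simp
  rw [this]
  have := lt_of_le_of_ne h1 (Ne.symm h3)
  positivity

end EJA

open scoped BigOperators Classical
set_option linter.unusedSectionVars false
namespace EJA

variable {J : Type} [NormedAddCommGroup J] [NormedSpace ℝ J] [FiniteDimensional ℝ J]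

theorem one_le_tau_idem (A : EJA J) {c : J} (hc : A.mul c c = c) (h0 : c ≠ 0) : 1 ≤ A.tau c := by
  have h2 := trace_idem_nonneg (A.prh_idem hc)
  have h3 : LinearMap.trace ℝ J (A.pr1 c) ≠ 0 := by
    intro h
    rw [LinearMap.IsIdempotentElem.trace_eq_zero_iff (A.pr1_idem hc)] at h
    have := congrArg (fun f => f c) h
    simp only [pr1, LinearMap.sub_apply, LinearMap.smul_apply, Module.End.mul_apply, hc,
      LinearMap.zero_apply] at this
    apply h0
    rw [← this]; module
  have h4 : 1 ≤ LinearMap.trace ℝ J (A.pr1 c) := by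
    rw [LinearMap.IsProj.trace (LinearMap.IsIdempotentElem.isProj_range _ (A.pr1_idem hc))] at h3 ⊢
    have : Module.finrank ℝ (LinearMap.range (A.pr1 c)) ≠ 0 := by exact_mod_cast h3
    exact_mod_cast Nat.one_le_iff_ne_zero.mpr this
  have : A.tau c = LinearMap.trace ℝ J (A.pr1 c) + (1/2) * LinearMap.trace ℝ J (A.prh c) := by
    unfold tau
    rw [LinearMap.comp_apply]
    conv_lhs => rw [A.mul_eq_pr c]
    simp
  rw [this]
  linarith

/-! ### Frames -/

theorem frame_mul (A : EJA J) {m : ℕ} {c : Fin m → J} (hc : A.IsFrame c) (i j : Fin m) :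
    A.mul (c i) (c j) = if i = j then c j else 0 := by
  split_ifs with h
  · subst h; exact (hc.1 i).1
  · exact hc.2.1 i j h

theorem frame_idem (A : EJA J) {m : ℕ} {c : Fin m → J} (hc : A.IsFrame c) (i : Fin m) :
    A.mul (c i) (c i) = c i := (hc.1 i).1

theorem frame_ne (A : EJA J) {m : ℕ} {c : Fin m → J} (hc : A.IsFrame c) (i : Fin m) :
    c i ≠ 0 := (hc.1 i).2.1

theorem frame_sum (A : EJA J) {m : ℕ} {c : Fin m → J} (hc : A.IsFrame c) :
    ∑ j, c j = A.e := hc.2.2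

theorem frame_mul_sum (A : EJA J) {m : ℕ} {c : Fin m → J} (hc : A.IsFrame c) (l : Fin m → ℝ)
    (j : Fin m) : A.mul (c j) (∑ i, l i • c i) = l j • c j := by
  simp only [map_sum, map_smul, A.frame_mul hc, smul_ite, smul_zero]
  simp

theorem frame_sum_mul_sum (A : EJA J) {m : ℕ} {c : Fin m → J} (hc : A.IsFrame c)
    (k l : Fin m → ℝ) :
    A.mul (∑ i, k i • c i) (∑ i, l i • c i) = ∑ i, (k i * l i) • c i := by
  rw [map_sum]
  refine Finset.sum_congr rfl fun i _ => ?_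
  rw [map_smul, A.comm, A.frame_mul_sum hc, smul_smul, mul_comm]

theorem frame_sum_mul (A : EJA J) {m : ℕ} {c : Fin m → J} (hc : A.IsFrame c) (v : J) :
    ∑ j, A.mul (c j) v = v := by
  rw [← LinearMap.sum_apply, ← map_sum, A.frame_sum hc, A.unit_mul]

theorem ip_frame (A : EJA J) {m : ℕ} {c : Fin m → J} (hc : A.IsFrame c) (l : Fin m → ℝ)
    (j : Fin m) : A.ip (∑ i, l i • c i) (c j) = l j * A.tau (c j) := by
  unfold ip
  rw [A.comm, A.frame_mul_sum hc, map_smul, smul_eq_mul]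

theorem frame_coeff_unique (A : EJA J) {m : ℕ} {c : Fin m → J} (hc : A.IsFrame c)
    {l k : Fin m → ℝ} (h : ∑ i, l i • c i = ∑ i, k i • c i) : l = k := by
  funext j
  have h1 := A.ip_frame hc l j
  rw [h, A.ip_frame hc k j] at h1
  have := A.tau_idem_pos (A.frame_idem hc j) (A.frame_ne hc j)
  exact (mul_right_cancel₀ this.ne' h1).symm

theorem ip_self_frame (A : EJA J) {m : ℕ} {c : Fin m → J} (hc : A.IsFrame c) (l : Fin m → ℝ) :
    A.ip (∑ i, l i • c i) (∑ i, l i • c i) = ∑ i, l i ^ 2 * A.tau (c i) := by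
  unfold ip
  rw [A.frame_sum_mul_sum hc, map_sum]
  refine Finset.sum_congr rfl fun i _ => ?_
  rw [map_smul, smul_eq_mul, sq]

theorem ip_self_nonneg (A : EJA J) (x : J) : 0 ≤ A.ip x x := by
  obtain ⟨c, l, hc, rfl⟩ := A.spectral x
  rw [A.ip_self_frame hc]
  refine Finset.sum_nonneg fun i _ => mul_nonneg (sq_nonneg _) ?_
  exact (A.tau_idem_pos (A.frame_idem hc i) (A.frame_ne hc i)).le

theorem ip_self_eq_zero (A : EJA J) {x : J} (h : A.ip x x = 0) : x = 0 := by
  obtain ⟨c, l, hc, rfl⟩ := A.spectral x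
  rw [A.ip_self_frame hc, Finset.sum_eq_zero_iff_of_nonneg] at h
  · refine Finset.sum_eq_zero fun i hi => ?_
    have h1 := h i hi
    have h2 := A.tau_idem_pos (A.frame_idem hc i) (A.frame_ne hc i)
    have : l i = 0 := by
      rcases mul_eq_zero.mp h1 with h | h
      · exact pow_eq_zero_iff (two_ne_zero) |>.mp h
      · exact absurd h h2.ne'
    simp [this]
  · exact fun i _ => mul_nonneg (sq_nonneg _)
      (A.tau_idem_pos (A.frame_idem hc i) (A.frame_ne hc i)).le

theorem ip_self_pos (A : EJA J) {x : J} (h : x ≠ 0) : 0 < A.ip x x :=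
  lt_of_le_of_ne (A.ip_self_nonneg x) (fun h' => h (A.ip_self_eq_zero h'.symm))

theorem ip_idem_eq (A : EJA J) {c : J} (hc : A.mul c c = c) (y : J) :
    A.ip (A.mul c y) y = A.ip (A.pr1 c y) (A.pr1 c y) + (1/2) * A.ip (A.prh c y) (A.prh c y) := by
  have s1 : ∀ u v, A.ip (A.pr1 c u) v = A.ip u (A.pr1 c v) := by
    intro u v
    simp only [pr1, LinearMap.sub_apply, LinearMap.smul_apply, Module.End.mul_apply, ip_sub_left,
      ip_sub_right, ip_smul_left, ip_smul_right, A.ip_mul]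
  have s2 : ∀ u v, A.ip (A.prh c u) v = A.ip u (A.prh c v) := by
    intro u v
    simp only [prh, LinearMap.sub_apply, LinearMap.smul_apply, Module.End.mul_apply, ip_sub_left,
      ip_sub_right, ip_smul_left, ip_smul_right, A.ip_mul]
  rw [s1, s2]
  have e1 : A.pr1 c (A.pr1 c y) = A.pr1 c y := by
    rw [← Module.End.mul_apply, (A.pr1_idem hc).eq]
  have e2 : A.prh c (A.prh c y) = A.prh c y := by
    rw [← Module.End.mul_apply, (A.prh_idem hc).eq]
  rw [e1, e2, A.ip_comm]
  conv_lhs => rw [A.mul_eq_pr c]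
  simp [ip_add_right, ip_smul_right]

theorem ip_idem_nonneg (A : EJA J) {c : J} (hc : A.mul c c = c) (y : J) :
    0 ≤ A.ip (A.mul c y) y := by
  rw [A.ip_idem_eq hc]
  have := A.ip_self_nonneg (A.pr1 c y)
  have := A.ip_self_nonneg (A.prh c y)
  positivity

theorem ip_idem_zero (A : EJA J) {c : J} (hc : A.mul c c = c) {y : J}
    (h : A.ip (A.mul c y) y = 0) : A.mul c y = 0 := by
  rw [A.ip_idem_eq hc] at h
  have h1 := A.ip_self_nonneg (A.pr1 c y)
  have h2 := A.ip_self_nonneg (A.prh c y)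
  have e1 := A.ip_self_eq_zero (x := A.pr1 c y) (by linarith)
  have e2 := A.ip_self_eq_zero (x := A.prh c y) (by linarith)
  rw [A.mul_eq_pr c]
  simp [e1, e2]

theorem ip_idem_idem (A : EJA J) {c d : J} (hd : A.mul d d = d) :
    A.ip c d = A.ip (A.mul c d) d := by
  conv_lhs => rw [← hd]
  rw [A.ip_comm, A.ip_mul, A.ip_comm d, A.comm d c]

theorem ip_idem_idem_nonneg (A : EJA J) {c d : J} (hc : A.mul c c = c) (hd : A.mul d d = d) :
    0 ≤ A.ip c d := by
  rw [A.ip_idem_idem hd]; exact A.ip_idem_nonneg hc d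

theorem ip_idem_idem_zero (A : EJA J) {c d : J} (hc : A.mul c c = c) (hd : A.mul d d = d)
    (h : A.ip c d = 0) : A.mul c d = 0 := by
  rw [A.ip_idem_idem hd] at h; exact A.ip_idem_zero hc h

/-! ### The cone of squares -/

def sq (A : EJA J) : Set J := {x : J | ∃ y : J, x = A.mul y y}

theorem sum_mem_sq (A : EJA J) {m : ℕ} {c : Fin m → J} (hc : A.IsFrame c) {l : Fin m → ℝ}
    (hl : ∀ i, 0 ≤ l i) : ∑ i, l i • c i ∈ A.sq := by
  refine ⟨∑ i, Real.sqrt (l i) • c i, ?_⟩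
  rw [A.frame_sum_mul_sum hc]
  simp only [Real.mul_self_sqrt (hl _)]

theorem sq_spectral (A : EJA J) {x : J} (hx : x ∈ A.sq) :
    ∃ (c : Fin A.rank → J) (l : Fin A.rank → ℝ), A.IsFrame c ∧ (∀ i, 0 ≤ l i) ∧
      x = ∑ j, l j • c j := by
  obtain ⟨y, rfl⟩ := hx
  obtain ⟨c, l, hc, rfl⟩ := A.spectral y
  exact ⟨c, fun i => l i * l i, hc, fun i => mul_self_nonneg _, A.frame_sum_mul_sum hc l l⟩

theorem idem_mem_sq (A : EJA J) {c : J} (hc : A.mul c c = c) : c ∈ A.sq := ⟨c, hc.symm⟩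

theorem ip_double (A : EJA J) {m n : ℕ} (c : Fin m → J) (d : Fin n → J) (l : Fin m → ℝ)
    (k : Fin n → ℝ) : A.ip (∑ i, l i • c i) (∑ j, k j • d j)
      = ∑ i, ∑ j, l i * (k j * A.ip (c i) (d j)) := by
  rw [ip_sum_left]
  refine Finset.sum_congr rfl fun i _ => ?_
  rw [ip_smul_left, ip_sum_right, Finset.mul_sum]
  refine Finset.sum_congr rfl fun j _ => ?_
  rw [ip_smul_right]

theorem ip_nonneg (A : EJA J) {x y : J} (hx : x ∈ A.sq) (hy : y ∈ A.sq) : 0 ≤ A.ip x y := by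
  obtain ⟨c, l, hc, hl, rfl⟩ := A.sq_spectral hx
  obtain ⟨d, k, hd, hk, rfl⟩ := A.sq_spectral hy
  rw [ip_double]
  refine Finset.sum_nonneg fun i _ => Finset.sum_nonneg fun j _ => ?_
  exact mul_nonneg (hl _) (mul_nonneg (hk _)
    (A.ip_idem_idem_nonneg (A.frame_idem hc _) (A.frame_idem hd _)))

theorem sq_of_dual (A : EJA J) {x : J} (h : ∀ y ∈ A.sq, 0 ≤ A.ip x y) : x ∈ A.sq := by
  obtain ⟨c, l, hc, rfl⟩ := A.spectral x
  refine A.sum_mem_sq hc fun i => ?_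
  have h1 := h _ (A.idem_mem_sq (A.frame_idem hc i))
  rw [A.ip_frame hc] at h1
  exact nonneg_of_mul_nonneg_left h1 (A.tau_idem_pos (A.frame_idem hc i) (A.frame_ne hc i))

theorem coeff_nonneg (A : EJA J) {m : ℕ} {c : Fin m → J} (hc : A.IsFrame c) {l : Fin m → ℝ}
    (h : ∑ i, l i • c i ∈ A.sq) (i : Fin m) : 0 ≤ l i := by
  have h1 := A.ip_nonneg h (A.idem_mem_sq (A.frame_idem hc i))
  rw [A.ip_frame hc] at h1
  exact nonneg_of_mul_nonneg_left h1 (A.tau_idem_pos (A.frame_idem hc i) (A.frame_ne hc i))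

theorem sq_add (A : EJA J) {x y : J} (hx : x ∈ A.sq) (hy : y ∈ A.sq) : x + y ∈ A.sq := by
  refine A.sq_of_dual fun z hz => ?_
  rw [ip_add_left]
  exact add_nonneg (A.ip_nonneg hx hz) (A.ip_nonneg hy hz)

theorem sq_smul (A : EJA J) {x : J} (hx : x ∈ A.sq) {t : ℝ} (ht : 0 ≤ t) : t • x ∈ A.sq := by
  refine A.sq_of_dual fun z hz => ?_
  rw [ip_smul_left]
  exact mul_nonneg ht (A.ip_nonneg hx hz)

theorem sq_zero (A : EJA J) : (0:J) ∈ A.sq := ⟨0, by simp⟩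

theorem sq_sum (A : EJA J) {ι : Type*} (s : Finset ι) (f : ι → J) (h : ∀ i ∈ s, f i ∈ A.sq) :
    ∑ i ∈ s, f i ∈ A.sq := by
  induction s using Finset.induction_on with
  | empty => simpa using A.sq_zero
  | insert a s ha ih =>
    rw [Finset.sum_insert ha]
    exact A.sq_add (h _ (Finset.mem_insert_self _ _))
      (ih fun i hi => h i (Finset.mem_insert_of_mem hi))

theorem sq_antisymm (A : EJA J) {x : J} (hx : x ∈ A.sq) (hy : -x ∈ A.sq) : x = 0 := by
  have h := A.ip_nonneg hx hy
  have h2 := A.ip_self_nonneg x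
  rw [A.ip_comm, ip_neg_left] at h
  exact A.ip_self_eq_zero (by linarith)

theorem mul_eq_zero_of_ip (A : EJA J) {x y : J} (hx : x ∈ A.sq) (hy : y ∈ A.sq)
    (h : A.ip x y = 0) : A.mul x y = 0 := by
  obtain ⟨c, l, hc, hl, rfl⟩ := A.sq_spectral hx
  obtain ⟨d, k, hd, hk, rfl⟩ := A.sq_spectral hy
  have hnn : ∀ i j, 0 ≤ l i * (k j * A.ip (c i) (d j)) := fun i j =>
    mul_nonneg (hl _) (mul_nonneg (hk _)
    (A.ip_idem_idem_nonneg (A.frame_idem hc _) (A.frame_idem hd _)))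
  rw [ip_double] at h
  rw [Finset.sum_eq_zero_iff_of_nonneg (fun i _ => Finset.sum_nonneg fun j _ => hnn i j)] at h
  rw [map_sum]
  refine Finset.sum_eq_zero fun j hj => ?_
  rw [map_sum, LinearMap.sum_apply]
  refine Finset.sum_eq_zero fun i hi => ?_
  have h2 := h i hi
  rw [Finset.sum_eq_zero_iff_of_nonneg (fun j _ => hnn _ j)] at h2
  have h3 := h2 j hj
  rcases mul_eq_zero.mp h3 with h4 | h4
  · simp [h4]
  rcases mul_eq_zero.mp h4 with h5 | h5
  · simp [h5]
  · rw [map_smul, map_smul, LinearMap.smul_apply,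
      A.ip_idem_idem_zero (A.frame_idem hc _) (A.frame_idem hd _) h5]; simp

/-! ### Continuity -/

/-- `L(x)` as a continuous linear map. -/
noncomputable def Lc (A : EJA J) : J →ₗ[ℝ] (J →L[ℝ] J) :=
  (LinearMap.toContinuousLinearMap : (J →ₗ[ℝ] J) ≃ₗ[ℝ] (J →L[ℝ] J)).toLinearMap ∘ₗ A.mul

@[simp] theorem Lc_apply (A : EJA J) (x y : J) : A.Lc x y = A.mul x y := rfl

theorem continuous_mul (A : EJA J) : Continuous fun p : J × J => A.mul p.1 p.2 := by
  have h : Continuous A.Lc := LinearMap.continuous_of_finiteDimensional _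
  exact (h.comp continuous_fst).clm_apply continuous_snd

theorem continuous_tau (A : EJA J) : Continuous A.tau := LinearMap.continuous_of_finiteDimensional _

theorem continuous_ip (A : EJA J) : Continuous fun p : J × J => A.ip p.1 p.2 :=
  A.continuous_tau.comp A.continuous_mul

theorem isClosed_sq (A : EJA J) : IsClosed A.sq := by
  have : A.sq = ⋂ y ∈ A.sq, {x | 0 ≤ A.ip x y} := by
    ext x
    simp only [Set.mem_iInter, Set.mem_ofPred_eq]
    exact ⟨fun hx y hy => A.ip_nonneg hx hy, fun h => A.sq_of_dual h⟩
  rw [this]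
  refine isClosed_biInter fun y _ => ?_
  exact isClosed_le continuous_const
    (A.continuous_ip.comp (continuous_id.prodMk continuous_const))

theorem shift_mem_sq (A : EJA J) {v : J} {ε : ℝ} (hε : 0 < ε) (hv : A.ip v v < ε ^ 2) :
    v + ε • A.e ∈ A.sq := by
  obtain ⟨c, l, hc, rfl⟩ := A.spectral v
  rw [A.ip_self_frame hc] at hv
  rw [← A.frame_sum hc, Finset.smul_sum, ← Finset.sum_add_distrib]
  simp only [← add_smul]
  refine A.sum_mem_sq hc fun i => ?_
  have h1 : l i ^ 2 * A.tau (c i) ≤ ∑ i, l i ^ 2 * A.tau (c i) :=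
    Finset.single_le_sum (f := fun i => l i ^ 2 * A.tau (c i)) (fun i _ => mul_nonneg (sq_nonneg _)
      (A.tau_idem_pos (A.frame_idem hc i) (A.frame_ne hc i)).le) (Finset.mem_univ i)
  have h2 := A.one_le_tau_idem (A.frame_idem hc i) (A.frame_ne hc i)
  have h3 : l i ^ 2 < ε ^ 2 := by nlinarith [sq_nonneg (l i)]
  have := abs_lt_of_sq_lt_sq' h3 hε.le
  linarith [this.1]

theorem cone_eq (A : EJA J) : A.cone = interior A.sq := rfl

theorem add_e_mem_cone (A : EJA J) {x : J} (hx : x ∈ A.sq) {ε : ℝ} (hε : 0 < ε) :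
    x + ε • A.e ∈ A.cone := by
  rw [cone_eq, mem_interior]
  refine ⟨{y | A.ip (y - (x + ε • A.e)) (y - (x + ε • A.e)) < ε ^ 2}, ?_, ?_, ?_⟩
  · intro y hy
    have := A.sq_add hx (A.shift_mem_sq hε hy)
    have e : x + (y - (x + ε • A.e) + ε • A.e) = y := by abel
    rwa [e] at this
  · refine isOpen_lt ?_ continuous_const
    exact A.continuous_ip.comp ((continuous_id.sub continuous_const).prodMk
      (continuous_id.sub continuous_const))
  · simp only [Set.mem_ofPred_eq, sub_self, ip_zero_left]; positivity

theorem cone_subset_sq (A : EJA J) : A.cone ⊆ A.sq := interior_subset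

/-- A continuous linear map sending the open cone to the closed one preserves the closed one. -/
theorem map_sq_of_cone (A : EJA J) {g : J →L[ℝ] J} (hg : ∀ x ∈ A.cone, g x ∈ A.sq) {x : J}
    (hx : x ∈ A.sq) : g x ∈ A.sq := by
  have h1 : Filter.Tendsto (fun ε : ℝ => g (x + ε • A.e)) (nhdsWithin 0 (Set.Ioi 0))
      (nhds (g (x + (0:ℝ) • A.e))) := by
    apply Filter.Tendsto.mono_left _ nhdsWithin_le_nhds
    have : Continuous (fun ε : ℝ => g (x + ε • A.e)) := by fun_prop
    exact this.tendsto 0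
  rw [zero_smul, add_zero] at h1
  refine A.isClosed_sq.mem_of_tendsto h1 ?_
  filter_upwards [self_mem_nhdsWithin] with ε hε
  exact hg _ (A.add_e_mem_cone hx hε)

theorem conePreserving_sq (A : EJA J) {g : (J →L[ℝ] J)ˣ} (hg : g ∈ A.conePreserving) {x : J}
    (hx : x ∈ A.sq) : (g : J →L[ℝ] J) x ∈ A.sq := by
  refine A.map_sq_of_cone (fun y hy => A.cone_subset_sq ?_) hx
  have : (g : J →L[ℝ] J) y ∈ (g : J →L[ℝ] J) '' A.cone := ⟨y, hy, rfl⟩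
  rwa [show (g : J →L[ℝ] J) '' A.cone = A.cone from hg] at this

theorem units_inv_apply (g : (J →L[ℝ] J)ˣ) (x : J) :
    ((g⁻¹ : (J →L[ℝ] J)ˣ) : J →L[ℝ] J) ((g : J →L[ℝ] J) x) = x := by
  rw [← mul_apply_eq_comp, Units.inv_mul]; rfl

theorem units_apply_inv (g : (J →L[ℝ] J)ˣ) (x : J) :
    (g : J →L[ℝ] J) (((g⁻¹ : (J →L[ℝ] J)ˣ) : J →L[ℝ] J) x) = x := by
  rw [← mul_apply_eq_comp, Units.mul_inv]; rfl

theorem conePreserving_inv (A : EJA J) {g : (J →L[ℝ] J)ˣ} (hg : g ∈ A.conePreserving) :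
    g⁻¹ ∈ A.conePreserving := by
  have h : (g : J →L[ℝ] J) '' A.cone = A.cone := hg
  show ((g⁻¹ : (J →L[ℝ] J)ˣ) : J →L[ℝ] J) '' A.cone = A.cone
  conv_lhs => rw [← h]
  rw [Set.image_image]
  simp [units_inv_apply]

/-- A unit mapping squares to squares together with its inverse preserves the cone. -/
theorem mem_conePreserving (A : EJA J) {g : (J →L[ℝ] J)ˣ}
    (h1 : ∀ x ∈ A.sq, (g : J →L[ℝ] J) x ∈ A.sq)
    (h2 : ∀ x ∈ A.sq, ((g⁻¹ : (J →L[ℝ] J)ˣ) : J →L[ℝ] J) x ∈ A.sq) : g ∈ A.conePreserving := by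
  show (g : J →L[ℝ] J) '' A.cone = A.cone
  let e : J ≃L[ℝ] J := ContinuousLinearEquiv.unitsEquiv ℝ J g
  have he : ∀ x, (g : J →L[ℝ] J) x = e.toHomeomorph x := fun x => rfl
  have himg : ∀ s : Set J, (g : J →L[ℝ] J) '' s = e.toHomeomorph '' s := fun s =>
    Set.image_congr fun x _ => he x
  rw [himg, cone_eq, e.toHomeomorph.image_interior, ← himg]
  congr 1
  ext x
  constructor
  · rintro ⟨y, hy, rfl⟩; exact h1 y hy
  · intro hx; exact ⟨_, h2 x hx, units_apply_inv g x⟩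

end EJA

open scoped BigOperators Classical
set_option linter.unusedSectionVars false
namespace EJA

variable {J : Type} [NormedAddCommGroup J] [NormedSpace ℝ J] [FiniteDimensional ℝ J]

/-! ### Exponentials -/

theorem cexp_add (T : J →L[ℝ] J) (s t : ℝ) :
    NormedSpace.exp (s • T) * NormedSpace.exp (t • T) = NormedSpace.exp ((s + t) • T) := by
  let _ : NormedAlgebra ℚ (J →L[ℝ] J) := NormedAlgebra.restrictScalars ℚ ℝ (J →L[ℝ] J)
  rw [add_smul]
  exact (NormedSpace.exp_add_of_commute (((Commute.refl T).smul_left s).smul_right t)).symm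

theorem cexp_zero (T : J →L[ℝ] J) : NormedSpace.exp ((0:ℝ) • T) = 1 := by
  rw [zero_smul, NormedSpace.exp_zero]

theorem cexp_neg_mul (T : J →L[ℝ] J) :
    NormedSpace.exp (-T) * NormedSpace.exp T = 1 := by
  have := cexp_add T (-1) 1
  simpa using this

theorem cexp_mul_neg (T : J →L[ℝ] J) :
    NormedSpace.exp T * NormedSpace.exp (-T) = 1 := by
  have := cexp_add T 1 (-1)
  simpa using this

theorem cexp_continuous (T : J →L[ℝ] J) : Continuous fun t : ℝ => NormedSpace.exp (t • T) :=
  continuous_iff_continuousAt.2 fun t => (hasDerivAt_exp_smul_const (𝕂 := ℝ) T t).continuousAt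

theorem cexp_nsmul (T : J →L[ℝ] J) (n : ℕ) (hn : n ≠ 0) :
    NormedSpace.exp ((1 / (n:ℝ)) • T) ^ n = NormedSpace.exp T := by
  let _ : NormedAlgebra ℚ (J →L[ℝ] J) := NormedAlgebra.restrictScalars ℚ ℝ (J →L[ℝ] J)
  rw [← NormedSpace.exp_nsmul, ← Nat.cast_smul_eq_nsmul ℝ, smul_smul]
  have : (n:ℝ) ≠ 0 := by exact_mod_cast hn
  rw [mul_one_div_cancel this, one_smul]

theorem norm_one_add_pow (D : J →L[ℝ] J) (n : ℕ) : ‖(1 + D) ^ n - 1‖ ≤ (1 + ‖D‖) ^ n - 1 := by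
  induction n with
  | zero => simp
  | succ n ih =>
    have e : (1 + D) ^ (n + 1) - 1 = ((1 + D) ^ n - 1) + ((1 + D) ^ n - 1) * D + D := by
      rw [pow_succ]; noncomm_ring
    rw [e]
    have h1 := norm_add_le (((1 + D) ^ n - 1) + ((1 + D) ^ n - 1) * D) D
    have h2 := norm_add_le ((1 + D) ^ n - 1) (((1 + D) ^ n - 1) * D)
    have h3 := norm_mul_le ((1 + D) ^ n - 1) D
    have h4 := norm_nonneg D
    have h5 : ‖(1 + D) ^ n - 1‖ * ‖D‖ ≤ ((1 + ‖D‖) ^ n - 1) * ‖D‖ :=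
      mul_le_mul_of_nonneg_right ih h4
    rw [pow_succ]
    nlinarith

theorem tendsto_pow_one (T : J →L[ℝ] J) :
    Filter.Tendsto (fun n : ℕ => (NormedSpace.exp ((1 / (n:ℝ)) • T) * (1 - (1 / (n:ℝ)) • T)) ^ n)
      Filter.atTop (nhds 1) := by
  let φ : ℝ → (J →L[ℝ] J) := fun h => NormedSpace.exp (h • T) * (1 - h • T) - 1
  have hφ : HasDerivAt φ 0 0 := by
    have h1 := hasDerivAt_exp_smul_const (𝕂 := ℝ) T 0
    have h2 : HasDerivAt (fun h : ℝ => (1 : J →L[ℝ] J) - h • T) (-T) 0 := by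
      have := ((hasDerivAt_id (0:ℝ)).smul_const T).const_sub (1 : J →L[ℝ] J)
      simpa using this
    have h3 := (h1.mul h2).sub_const (1 : J →L[ℝ] J)
    refine h3.congr_deriv ?_
    simp [NormedSpace.exp_zero]
  have hφ0 : φ 0 = 0 := by simp [φ, NormedSpace.exp_zero]
  have ht : Filter.Tendsto (fun n : ℕ => (n:ℝ) • φ (1 / (n:ℝ))) Filter.atTop (nhds 0) := by
    have h1 := hφ.tendsto_slope_zero
    have h2 : Filter.Tendsto (fun n : ℕ => 1 / (n:ℝ)) Filter.atTop (nhdsWithin 0 {0}ᶜ) := by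
      rw [tendsto_nhdsWithin_iff]
      refine ⟨tendsto_one_div_atTop_nhds_zero_nat, ?_⟩
      filter_upwards [Filter.eventually_gt_atTop 0] with n hn
      have : (n:ℝ) ≠ 0 := by exact_mod_cast hn.ne'
      simpa using this
    have h3 := h1.comp h2
    refine h3.congr fun n => ?_
    simp [hφ0]
  have ht2 : Filter.Tendsto (fun n : ℕ => Real.exp ‖(n:ℝ) • φ (1 / (n:ℝ))‖ - 1) Filter.atTop
      (nhds 0) := by
    have h1 : Filter.Tendsto (fun n : ℕ => ‖(n:ℝ) • φ (1 / (n:ℝ))‖) Filter.atTop (nhds 0) := by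
      simpa using ht.norm
    have h2 := (Real.continuous_exp.tendsto 0).comp h1
    simpa using h2.sub_const 1
  rw [tendsto_iff_norm_sub_tendsto_zero]
  refine squeeze_zero (fun _ => norm_nonneg _) (fun n => ?_) ht2
  have e : NormedSpace.exp ((1 / (n:ℝ)) • T) * (1 - (1 / (n:ℝ)) • T) = 1 + φ (1 / (n:ℝ)) := by
    simp [φ]
  rw [e]
  refine (norm_one_add_pow _ n).trans ?_
  have h1 : 1 + ‖φ (1 / (n:ℝ))‖ ≤ Real.exp ‖φ (1 / (n:ℝ))‖ := by
    rw [add_comm]; exact Real.add_one_le_exp _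
  have h2 : (1 + ‖φ (1 / (n:ℝ))‖) ^ n ≤ Real.exp ‖(n:ℝ) • φ (1 / (n:ℝ))‖ := by
    rw [norm_smul, Real.norm_natCast, Real.exp_nat_mul]
    exact pow_le_pow_left₀ (by positivity) h1 n
  linarith

theorem exists_bound (A : EJA J) (z : J) : ∃ M : ℝ, 0 < M ∧ ∀ v, A.ip (A.mul z v) v ≤ M * A.ip v v := by
  obtain ⟨c, l, hc, rfl⟩ := A.spectral z
  refine ⟨1 + ∑ i, |l i|, by positivity, fun v => ?_⟩
  have e : (1 + ∑ i, |l i|) * A.ip v v = ∑ j, (1 + ∑ i, |l i|) * A.ip (A.mul (c j) v) v := by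
    rw [← Finset.mul_sum, ← ip_sum_left, A.frame_sum_mul hc]
  rw [e, map_sum, LinearMap.sum_apply, ip_sum_left]
  refine Finset.sum_le_sum fun j _ => ?_
  rw [map_smul, LinearMap.smul_apply, ip_smul_left]
  refine mul_le_mul_of_nonneg_right ?_ (A.ip_idem_nonneg (A.frame_idem hc j) v)
  have := Finset.single_le_sum (f := fun i => |l i|) (fun i _ => abs_nonneg _) (Finset.mem_univ j)
  have := le_abs_self (l j)
  linarith

/-- Backward Euler step. -/
theorem euler_step (A : EJA J) (z : J) {M h : ℝ} (hM : ∀ v, A.ip (A.mul z v) v ≤ M * A.ip v v)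
    (h0 : 0 ≤ h) (h1 : h * M < 1) {x : J} (hx : x - h • A.mul z x ∈ A.sq) : x ∈ A.sq := by
  obtain ⟨c, l, hc, hxc⟩ := A.spectral x
  set xp := ∑ i, (max (l i) 0) • c i with hxp
  set xm := ∑ i, (max (-l i) 0) • c i with hxm
  have hp : xp ∈ A.sq := A.sum_mem_sq hc fun i => le_max_right _ _
  have hm : xm ∈ A.sq := A.sum_mem_sq hc fun i => le_max_right _ _
  have hdec : x = xp - xm := by
    rw [hxc, hxp, hxm, ← Finset.sum_sub_distrib]
    refine Finset.sum_congr rfl fun i _ => ?_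
    rw [← sub_smul]
    congr 1
    rcases le_total 0 (l i) with h | h
    · rw [max_eq_left h, max_eq_right (by linarith)]; ring
    · rw [max_eq_right h, max_eq_left (by linarith)]; ring
  have hpm : A.mul xp xm = 0 := by
    rw [hxp, hxm, A.frame_sum_mul_sum hc]
    refine Finset.sum_eq_zero fun i _ => ?_
    have : max (l i) 0 * max (-l i) 0 = 0 := by
      rcases le_total 0 (l i) with h | h
      · rw [max_eq_right (a := -l i) (by linarith)]; ring
      · rw [max_eq_right h]; ring
    rw [this, zero_smul]
  have e1 : A.ip xp xm = 0 := by unfold ip; rw [hpm, map_zero]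
  have e2 : A.ip (A.mul z xp) xm = 0 := by
    rw [A.comm z xp, A.ip_mul, hpm, ip_zero_right]
  have h2 := A.ip_nonneg hx hm
  have h3 := hM xm
  rw [hdec] at h2
  simp only [map_sub, ip_sub_left, ip_smul_left, e1, e2] at h2
  have h4 := A.ip_self_nonneg xm
  have h5 : A.ip xm xm = 0 := by
    have : h * A.ip (A.mul z xm) xm ≤ h * (M * A.ip xm xm) := mul_le_mul_of_nonneg_left h3 h0
    nlinarith
  rw [hdec, A.ip_self_eq_zero h5, sub_zero]
  exact hp

theorem exp_mem_sq (A : EJA J) (z : J) {y : J} (hy : y ∈ A.sq) :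
    NormedSpace.exp (A.Lc z) y ∈ A.sq := by
  refine A.map_sq_of_cone (fun y hy => ?_) hy
  obtain ⟨M, hM0, hM⟩ := A.exists_bound z
  have h1 : Filter.Tendsto (fun n : ℕ => ((NormedSpace.exp ((1 / (n:ℝ)) • A.Lc z) *
      (1 - (1 / (n:ℝ)) • A.Lc z)) ^ n) y) Filter.atTop (nhds y) := by
    have := (ContinuousLinearMap.apply ℝ J y).continuous.tendsto (1 : J →L[ℝ] J)
    exact this.comp (tendsto_pow_one (A.Lc z))
  have h2 : ∀ᶠ n : ℕ in Filter.atTop, ((NormedSpace.exp ((1 / (n:ℝ)) • A.Lc z) *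
      (1 - (1 / (n:ℝ)) • A.Lc z)) ^ n) y ∈ A.cone :=
    h1.eventually (isOpen_interior.mem_nhds hy)
  have h3 : ∀ᶠ n : ℕ in Filter.atTop, 1 / (n:ℝ) * M < 1 := by
    have : Filter.Tendsto (fun n : ℕ => 1 / (n:ℝ) * M) Filter.atTop (nhds (0 * M)) :=
      tendsto_one_div_atTop_nhds_zero_nat.mul_const M
    rw [zero_mul] at this
    exact this.eventually (gt_mem_nhds one_pos)
  obtain ⟨n, hn2, hn3, hn0⟩ := (h2.and (h3.and (Filter.eventually_gt_atTop 0))).exists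
  have hcomm : Commute (NormedSpace.exp ((1 / (n:ℝ)) • A.Lc z)) (1 - (1 / (n:ℝ)) • A.Lc z) := by
    apply Commute.exp_left
    exact (Commute.one_right _).sub_right (Commute.refl _)
  rw [hcomm.eq, hcomm.symm.mul_pow, cexp_nsmul _ n hn0.ne'] at hn2
  have key : ∀ (m : ℕ) (x : J), ((1 - (1 / (n:ℝ)) • A.Lc z) ^ m) x ∈ A.sq → x ∈ A.sq := by
    intro m
    induction m with
    | zero => intro x hx; simpa using hx
    | succ m ih =>
      intro x hx
      rw [pow_succ] at hx
      have := ih _ hx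
      exact A.euler_step z hM (by positivity) hn3 this
  exact key n _ (A.cone_subset_sq hn2)

/-- `exp L(z)` as a unit. -/
noncomputable def expU (T : J →L[ℝ] J) : (J →L[ℝ] J)ˣ where
  val := NormedSpace.exp T
  inv := NormedSpace.exp (-T)
  val_inv := cexp_mul_neg T
  inv_val := cexp_neg_mul T

theorem expU_mem (A : EJA J) (z : J) : expU (A.Lc z) ∈ A.conePreserving := by
  refine A.mem_conePreserving (fun x hx => A.exp_mem_sq z hx) (fun x hx => ?_)
  have := A.exp_mem_sq (-z) hx
  rw [map_neg] at this
  exact this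

/-- eigenvectors -/
theorem exp_apply_eig (T : J →L[ℝ] J) {v : J} {a : ℝ} (h : T v = a • v) :
    NormedSpace.exp T v = Real.exp a • v := by
  let _ : NormedAlgebra ℚ (J →L[ℝ] J) := NormedAlgebra.restrictScalars ℚ ℝ (J →L[ℝ] J)
  let f : ℝ → J := fun t => Real.exp (-(t * a)) • NormedSpace.exp (t • T) v
  have hf : ∀ t, HasDerivAt f 0 t := by
    intro t
    have h1 : HasDerivAt (fun t : ℝ => NormedSpace.exp (t • T) v)
        ((NormedSpace.exp (t • T) * T) v) t := by
      have := (hasDerivAt_exp_smul_const (𝕂 := ℝ) T t).clm_apply (hasDerivAt_const t v)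
      simpa using this
    have h2 : HasDerivAt (fun t : ℝ => Real.exp (-(t * a))) (Real.exp (-(t * a)) * (-a)) t := by
      have := (((hasDerivAt_id t).mul_const a).neg).exp
      simpa using this
    have h3 := h2.smul h1
    refine h3.congr_deriv ?_
    rw [mul_apply_eq_comp, h, map_smul, smul_smul]
    module
  have hd : Differentiable ℝ f := fun t => (hf t).differentiableAt
  have hc := is_const_of_deriv_eq_zero hd (fun t => (hf t).deriv) 1 0
  simp only [f, one_mul, one_smul, zero_mul, neg_zero, Real.exp_zero, zero_smul,
    NormedSpace.exp_zero, one_apply_eq_self] at hc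
  conv_rhs => rw [← hc]
  rw [smul_smul, ← Real.exp_add, add_neg_cancel, Real.exp_zero, one_smul]

/-! ### Automorphisms -/

/-- Isometric endomorphisms of the algebra. -/
def autSet (A : EJA J) : Set (J →L[ℝ] J) :=
  {g | (∀ x y, g (A.mul x y) = A.mul (g x) (g y)) ∧ ∀ x y, A.ip (g x) (g y) = A.ip x y}

theorem exp_deriv_mul (A : EJA J) (D : J →L[ℝ] J)
    (hD : ∀ x y, D (A.mul x y) = A.mul (D x) y + A.mul x (D y)) (x y : J) :
    NormedSpace.exp D (A.mul x y) = A.mul (NormedSpace.exp D x) (NormedSpace.exp D y) := by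
  let E : ℝ → (J →L[ℝ] J) := fun t => NormedSpace.exp (t • D)
  let F : ℝ → (J →L[ℝ] J) := fun t => NormedSpace.exp (t • (-D))
  let B : J →L[ℝ] (J →L[ℝ] J) := LinearMap.toContinuousLinearMap A.Lc
  have hB : ∀ u v, B u v = A.mul u v := fun u v => rfl
  let f : ℝ → J := fun t => F t (B (E t x) (E t y))
  have hE : ∀ t v, HasDerivAt (fun t => E t v) (D (E t v)) t := by
    intro t v
    have := (hasDerivAt_exp_smul_const' (𝕂 := ℝ) D t).clm_apply (hasDerivAt_const t v)
    simpa using this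
  have hf : ∀ t, HasDerivAt f 0 t := by
    intro t
    have h1 : HasDerivAt (fun t => B (E t x)) (B (D (E t x))) t :=
      B.hasFDerivAt.comp_hasDerivAt t (hE t x)
    have h2 := h1.clm_apply (hE t y)
    have h3 := (hasDerivAt_exp_smul_const (𝕂 := ℝ) (-D) t).clm_apply h2
    refine h3.congr_deriv ?_
    simp only [hB, mul_apply_eq_comp, ContinuousLinearMap.neg_apply, hD, map_add, map_neg]
    abel
  have hd : Differentiable ℝ f := fun t => (hf t).differentiableAt
  have hc := is_const_of_deriv_eq_zero hd (fun t => (hf t).deriv) 1 0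
  simp only [f, F, E, one_smul, zero_smul, NormedSpace.exp_zero,
    one_apply_eq_self, hB] at hc
  rw [← hc, ← mul_apply_eq_comp, cexp_mul_neg]; rfl

theorem tau_aut (A : EJA J) (e : J ≃ₗ[ℝ] J) (he : ∀ x y, e (A.mul x y) = A.mul (e x) (e y)) (x : J) :
    A.tau (e x) = A.tau x := by
  have : A.mul (e x) = e.conj (A.mul x) := by
    ext y
    rw [LinearEquiv.conj_apply_apply, he, LinearEquiv.apply_symm_apply]
  unfold tau
  rw [LinearMap.comp_apply, LinearMap.comp_apply, this, LinearMap.trace_conj']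

theorem exp_deriv_mem (A : EJA J) (D : J →L[ℝ] J)
    (hD : ∀ x y, D (A.mul x y) = A.mul (D x) y + A.mul x (D y)) :
    NormedSpace.exp D ∈ A.autSet := by
  refine ⟨A.exp_deriv_mul D hD, fun x y => ?_⟩
  unfold ip
  rw [← A.exp_deriv_mul D hD]
  exact A.tau_aut (ContinuousLinearEquiv.unitsEquiv ℝ J (expU D)).toLinearEquiv
    (A.exp_deriv_mul D hD) _

/-- inner derivation `[L(u), L(v)]`. -/
noncomputable def inn (A : EJA J) (u v : J) : J →L[ℝ] J := A.Lc u * A.Lc v - A.Lc v * A.Lc u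

theorem inn_apply (A : EJA J) (u v x : J) :
    A.inn u v x = A.mul u (A.mul v x) - A.mul v (A.mul u x) := rfl

theorem inn_deriv (A : EJA J) (u v x y : J) :
    A.inn u v (A.mul x y) = A.mul (A.inn u v x) y + A.mul x (A.inn u v y) := by
  simp only [inn_apply]
  exact A.deriv_aux u v x y

theorem exp_inn_mem (A : EJA J) (u v : J) (t : ℝ) :
    NormedSpace.exp (t • A.inn u v) ∈ A.autSet := by
  refine A.exp_deriv_mem _ fun x y => ?_
  simp [inn_deriv]

theorem ip_inn (A : EJA J) (u v x y : J) : A.ip (A.inn u v x) y = - A.ip x (A.inn u v y) := by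
  simp only [inn_apply, ip_sub_left, ip_sub_right, A.ip_mul]
  ring

end EJA

open scoped BigOperators Classical
set_option linter.unusedSectionVars false
namespace EJA

variable {J : Type} [NormedAddCommGroup J] [NormedSpace ℝ J] [FiniteDimensional ℝ J]

/-! ### Extremal elements and invariance of the signature -/

theorem sum_smul_of_mul (A : EJA J) {c y : J} (hc : A.IsPrimitive c) (hy : A.mul c y = y) :
    ∃ t : ℝ, y = t • c := by
  have hcc : A.mul c c = c := hc.1
  obtain ⟨d, l, hd, hyd⟩ := A.spectral y
  have h1 : A.mul c (A.mul y y) = A.mul y y := A.mul_one_one hcc hy hy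
  have h2 : A.ip (A.mul y y) (A.e - c) = 0 := by
    unfold ip
    rw [map_sub, A.mul_e, A.comm (A.mul y y) c, h1, sub_self, map_zero]
  have h3 : A.mul y y = ∑ j, (l j * l j) • d j := by rw [hyd, A.frame_sum_mul_sum hd]
  rw [h3, ip_sum_left, Finset.sum_eq_zero_iff_of_nonneg] at h2
  · refine ⟨∑ j, l j, ?_⟩
    rw [Finset.sum_smul, hyd]
    refine Finset.sum_congr rfl fun j _ => ?_
    by_cases hl : l j = 0
    · simp [hl]
    have h4 := h2 j (Finset.mem_univ _)
    rw [ip_smul_left] at h4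
    have h5 : A.ip (d j) (A.e - c) = 0 := by
      rcases mul_eq_zero.1 h4 with h | h
      · exact absurd (mul_self_eq_zero.1 h) hl
      · exact h
    have h6 := A.ip_idem_idem_zero (A.frame_idem hd j) (A.idem_compl hcc) h5
    rw [map_sub, A.mul_e, sub_eq_zero, A.comm] at h6
    rcases hc.2.2 (d j) (A.frame_idem hd j) h6.symm with h | h
    · exact absurd h (A.frame_ne hd j)
    · rw [h]
  · intro i _
    rw [ip_smul_left]
    exact mul_nonneg (mul_self_nonneg _)
      (A.ip_idem_idem_nonneg (A.frame_idem hd i) (A.idem_compl hcc))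

/-- Extremal elements of the closed cone. -/
def extr (A : EJA J) : Set J := {x | x ∈ A.sq ∧ A.mul x x = A.tr x • x}

theorem isClosed_extr (A : EJA J) : IsClosed A.extr := by
  have htr : Continuous A.tr := LinearMap.continuous_of_finiteDimensional _
  have h : IsClosed {x : J | A.mul x x = A.tr x • x} :=
    isClosed_eq (A.continuous_mul.comp (continuous_id.prodMk continuous_id))
      (htr.smul continuous_id)
  exact A.isClosed_sq.inter h

theorem zero_mem_extr (A : EJA J) : (0:J) ∈ A.extr := ⟨A.sq_zero, by simp⟩

theorem smul_mem_extr (A : EJA J) {c : J} (hc : A.IsPrimitive c) {t : ℝ} (ht : 0 ≤ t) :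
    t • c ∈ A.extr := by
  have hcc : A.mul c c = c := hc.1
  refine ⟨A.sq_smul (A.idem_mem_sq hcc) ht, ?_⟩
  simp [hcc, A.tr_prim c hc]

theorem extr_cases (A : EJA J) {x : J} (hx : x ∈ A.extr) :
    x = 0 ∨ ∃ (t : ℝ) (c : J), 0 < t ∧ A.IsPrimitive c ∧ x = t • c := by
  obtain ⟨h1, h2⟩ := hx
  obtain ⟨c, l, hc, hl, hxc⟩ := A.sq_spectral h1
  by_cases h : ∀ i, l i = 0
  · left; rw [hxc]; simp [h]
  · right
    push Not at h
    obtain ⟨i, hi⟩ := h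
    have htr : A.tr x = ∑ j, l j := by
      rw [hxc, map_sum]
      refine Finset.sum_congr rfl fun j _ => ?_
      rw [map_smul, A.tr_prim _ (hc.1 j), smul_eq_mul, mul_one]
    have h3 : ∑ j, (l j * l j) • c j = ∑ j, ((A.tr x) * l j) • c j := by
      rw [← A.frame_sum_mul_sum hc, ← hxc, h2, hxc, Finset.smul_sum]
      simp only [smul_smul]
    have h4 := congrFun (A.frame_coeff_unique hc h3) i
    have h5 : l i = ∑ j, l j := by rw [← htr]; exact mul_right_cancel₀ hi h4
    rw [← Finset.add_sum_erase _ _ (Finset.mem_univ i)] at h5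
    have h6 : ∑ j ∈ Finset.univ.erase i, l j = 0 := by linarith
    rw [Finset.sum_eq_zero_iff_of_nonneg (fun j _ => hl j)] at h6
    refine ⟨l i, c i, lt_of_le_of_ne (hl i) (Ne.symm hi), hc.1 i, ?_⟩
    rw [hxc, ← Finset.add_sum_erase _ _ (Finset.mem_univ i), Finset.sum_eq_zero, add_zero]
    intro j hj
    rw [h6 j hj, zero_smul]

theorem extr_face (A : EJA J) {x y : J} (hx : x ∈ A.extr) (hy : y ∈ A.sq) (hxy : x - y ∈ A.sq) :
    ∃ t : ℝ, y = t • x := by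
  rcases A.extr_cases hx with rfl | ⟨t, c, ht, hc, rfl⟩
  · rw [zero_sub] at hxy
    exact ⟨0, by rw [A.sq_antisymm hy hxy]; simp⟩
  · have hcc : A.mul c c = c := hc.1
    have h0 := A.idem_compl hcc
    have h1 := A.ip_nonneg hxy (A.idem_mem_sq h0)
    have h2 := A.ip_nonneg hy (A.idem_mem_sq h0)
    have h3 : A.ip (t • c) (A.e - c) = 0 := by
      unfold ip; simp [A.mul_e, hcc]
    rw [ip_sub_left, h3] at h1
    have h4 := A.mul_eq_zero_of_ip hy (A.idem_mem_sq h0) (by linarith)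
    rw [map_sub, A.mul_e, sub_eq_zero, A.comm] at h4
    obtain ⟨s, hs⟩ := A.sum_smul_of_mul hc h4.symm
    exact ⟨s / t, by rw [smul_smul, div_mul_cancel₀ _ ht.ne', hs]⟩

theorem extr_of_face (A : EJA J) {x : J} (hx : x ∈ A.sq)
    (h : ∀ y ∈ A.sq, x - y ∈ A.sq → ∃ t : ℝ, y = t • x) : x ∈ A.extr := by
  obtain ⟨c, l, hc, hl, hxc⟩ := A.sq_spectral hx
  by_cases hz : ∀ i, l i = 0
  · have : x = 0 := by rw [hxc]; simp [hz]
    rw [this]; exact A.zero_mem_extr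
  · push Not at hz
    obtain ⟨i, hi⟩ := hz
    have hci := A.idem_mem_sq (A.frame_idem hc i)
    obtain ⟨t, ht⟩ := h (l i • c i) (A.sq_smul hci (hl i)) (by
      rw [hxc, ← Finset.add_sum_erase _ _ (Finset.mem_univ i), add_sub_cancel_left]
      exact A.sq_sum _ _ fun j _ => A.sq_smul (A.idem_mem_sq (A.frame_idem hc j)) (hl j))
    have ht0 : t ≠ 0 := by
      rintro rfl
      rw [zero_smul, smul_eq_zero] at ht
      exact ht.elim hi (A.frame_ne hc i)
    have hx2 : x = (l i / t) • c i := by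
      rw [div_eq_inv_mul, ← smul_smul, ht, smul_smul, inv_mul_cancel₀ ht0, one_smul]
    rw [hx2]
    refine A.smul_mem_extr (hc.1 i) ?_
    have h1 := A.ip_nonneg hx hci
    rw [hx2, ip_smul_left] at h1
    exact nonneg_of_mul_nonneg_left h1 (A.ip_self_pos (A.frame_ne hc i))

theorem extr_map (A : EJA J) {g : (J →L[ℝ] J)ˣ} (hg : g ∈ A.conePreserving) {x : J}
    (hx : x ∈ A.extr) : (g : J →L[ℝ] J) x ∈ A.extr := by
  refine A.extr_of_face (A.conePreserving_sq hg hx.1) fun y hy hxy => ?_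
  have h1 := A.conePreserving_sq (A.conePreserving_inv hg) hy
  have h2 := A.conePreserving_sq (A.conePreserving_inv hg) hxy
  rw [map_sub, units_inv_apply] at h2
  obtain ⟨t, ht⟩ := A.extr_face hx h1 h2
  refine ⟨t, ?_⟩
  rw [← map_smul, ← ht, units_apply_inv]

theorem pr1_apply (A : EJA J) (f x : J) :
    A.pr1 f x = (2:ℝ) • A.mul f (A.mul f x) - A.mul f x := rfl

theorem mul_pr1 (A : EJA J) {f : J} (hf : A.mul f f = f) (x : J) :
    A.mul f (A.pr1 f x) = A.pr1 f x := by
  have h := A.peirce_cubic hf x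
  rw [pr1_apply, map_sub, map_smul]
  linear_combination (norm := module) h

theorem pr1_of_one (A : EJA J) {f x : J} (hx : A.mul f x = x) : A.pr1 f x = x := by
  rw [pr1_apply, hx, hx]; module

theorem ip_pr1 (A : EJA J) (f x y : J) : A.ip (A.pr1 f x) y = A.ip x (A.pr1 f y) := by
  simp only [pr1_apply, ip_sub_left, ip_sub_right, ip_smul_left, ip_smul_right, A.ip_mul]

theorem pr1_mem_extr (A : EJA J) {f : J} (hf : A.mul f f = f) {x : J} (hx : x ∈ A.extr) :
    A.pr1 f x ∈ A.extr := by
  have hcub := A.peirce_cubic hf x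
  set xh := (4:ℝ) • A.mul f x - (4:ℝ) • A.mul f (A.mul f x) with hxh
  set x0 := x - A.pr1 f x - xh with hx0
  have e1 : A.mul f (A.pr1 f x) = A.pr1 f x := A.mul_pr1 hf x
  have eh : A.mul f xh = (1/2:ℝ) • xh := by
    rw [hxh, map_sub, map_smul, map_smul]
    linear_combination (norm := module) (-2:ℝ) • hcub
  have e0 : A.mul f x0 = 0 := by
    rw [hx0, map_sub, map_sub, e1, eh, hxh, pr1_apply]
    module
  have hsum : x = A.pr1 f x + xh + x0 := by rw [hx0]; abel
  have key : ∀ n : ℕ, NormedSpace.exp (A.Lc ((n:ℝ) • (f - A.e))) x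
      = A.pr1 f x + Real.exp (-(n/2:ℝ)) • xh + Real.exp (-n) • x0 := by
    intro n
    have a1 : NormedSpace.exp (A.Lc ((n:ℝ) • (f - A.e))) (A.pr1 f x)
        = Real.exp 0 • A.pr1 f x := by
      apply exp_apply_eig
      rw [Lc_apply]
      simp only [map_smul, map_sub, LinearMap.smul_apply, LinearMap.sub_apply, e1,
        A.unit_mul]
      module
    have ah : NormedSpace.exp (A.Lc ((n:ℝ) • (f - A.e))) xh
        = Real.exp (-(n/2:ℝ)) • xh := by
      apply exp_apply_eig
      rw [Lc_apply]
      simp only [map_smul, map_sub, LinearMap.smul_apply, LinearMap.sub_apply, eh,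
        A.unit_mul]
      module
    have a0 : NormedSpace.exp (A.Lc ((n:ℝ) • (f - A.e))) x0
        = Real.exp (-(n:ℝ)) • x0 := by
      apply exp_apply_eig
      rw [Lc_apply]
      simp only [map_smul, map_sub, LinearMap.smul_apply, LinearMap.sub_apply, e0,
        A.unit_mul]
      module
    conv_lhs => rw [hsum]
    rw [map_add, map_add, a1, ah, a0, Real.exp_zero, one_smul]
  have hlim : Filter.Tendsto (fun n : ℕ => A.pr1 f x + Real.exp (-(n/2:ℝ)) • xh
      + Real.exp (-(n:ℝ)) • x0) Filter.atTop (nhds (A.pr1 f x + (0:ℝ) • xh + (0:ℝ) • x0)) := by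
    have t1 : Filter.Tendsto (fun n : ℕ => Real.exp (-(n:ℝ))) Filter.atTop (nhds 0) :=
      Real.tendsto_exp_neg_atTop_nhds_zero.comp tendsto_natCast_atTop_atTop
    have t2 : Filter.Tendsto (fun n : ℕ => Real.exp (-(n/2:ℝ))) Filter.atTop (nhds 0) :=
      Real.tendsto_exp_neg_atTop_nhds_zero.comp
        (tendsto_natCast_atTop_atTop.atTop_div_const two_pos)
    exact (tendsto_const_nhds.add (t2.smul_const xh)).add (t1.smul_const x0)
  rw [zero_smul, zero_smul, add_zero, add_zero] at hlim
  refine A.isClosed_extr.mem_of_tendsto hlim (Filter.Eventually.of_forall fun n => ?_)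
  rw [← key n]
  exact A.extr_map (A.expU_mem ((n:ℝ) • (f - A.e))) hx

theorem key_lemma (A : EJA J) {ι : Type} (s : Finset ι) (v : ι → J) :
    (∀ i ∈ s, v i ∈ A.extr) → ∀ f : J, A.mul f f = f → (s.card : ℝ) < A.tr f →
    ∃ f', A.mul f' f' = f' ∧ f' ≠ 0 ∧ A.mul f f' = f' ∧ ∀ i ∈ s, A.ip f' (v i) = 0 := by
  induction s using Finset.induction_on with
  | empty =>
    intro _ f hf h
    refine ⟨f, hf, ?_, hf, by simp⟩
    rintro rfl
    simp at h
  | insert a s ha ih =>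
    intro hv f hf h
    rw [Finset.card_insert_of_notMem ha] at h
    push_cast at h
    have hva := A.pr1_mem_extr hf (hv a (Finset.mem_insert_self _ _))
    have ih' := ih fun i hi => hv i (Finset.mem_insert_of_mem hi)
    have hip : ∀ f', A.mul f f' = f' → A.ip f' (v a) = A.ip f' (A.pr1 f (v a)) := by
      intro f' h'
      rw [← ip_pr1, A.pr1_of_one h']
    rcases A.extr_cases hva with h0 | ⟨t, b, ht, hb, hw⟩
    · obtain ⟨f', h1, h2, h3, h4⟩ := ih' f hf (by linarith)
      refine ⟨f', h1, h2, h3, fun i hi => ?_⟩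
      rcases Finset.mem_insert.1 hi with rfl | hi
      · rw [hip f' h3, h0, ip_zero_right]
      · exact h4 i hi
    · have hbb : A.mul b b = b := hb.1
      have hfb : A.mul f b = b := by
        have := A.mul_pr1 hf (v a)
        rw [hw, map_smul] at this
        exact smul_right_injective J ht.ne' this
      have hf1 : A.mul (f - b) (f - b) = f - b := by
        simp only [map_sub, LinearMap.sub_apply, hf, hbb, hfb, A.comm b f]; abel
      have hf1b : A.mul (f - b) b = 0 := by
        simp only [map_sub, LinearMap.sub_apply, hbb, hfb, sub_self]
      obtain ⟨f', h1, h2, h3, h4⟩ := ih' (f - b) hf1 (by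
        rw [map_sub, A.tr_prim b hb]; linarith)
      have hfb' : A.mul f' b = 0 := A.mul_one_zero hf1 h3 hf1b
      have hff' : A.mul f f' = f' := by
        rw [map_sub, LinearMap.sub_apply, A.comm b, hfb', sub_zero] at h3
        exact h3
      refine ⟨f', h1, h2, hff', fun i hi => ?_⟩
      rcases Finset.mem_insert.1 hi with rfl | hi
      · rw [hip f' hff', hw, ip_smul_right]
        unfold ip
        rw [hfb', map_zero, mul_zero]
      · exact h4 i hi

theorem card_le_of_dom (A : EJA J) {m : ℕ} {d : Fin m → J} (hd : A.IsFrame d) (l : Fin m → ℝ)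
    {ι : Type} (s : Finset ι) (v : ι → J) (hv : ∀ i ∈ s, v i ∈ A.extr)
    (h : ∑ i ∈ s, v i - ∑ j, l j • d j ∈ A.sq) :
    (Finset.univ.filter fun j => 0 < l j).card ≤ s.card := by
  by_contra hlt
  push Not at hlt
  set P := Finset.univ.filter fun j => 0 < l j with hP
  have hPd : ∀ j, A.mul (∑ i ∈ P, d i) (d j) = if j ∈ P then d j else 0 := by
    intro j
    rw [map_sum, LinearMap.sum_apply]
    simp only [A.frame_mul hd]
    simp
  have hf : A.mul (∑ i ∈ P, d i) (∑ i ∈ P, d i) = ∑ i ∈ P, d i := by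
    rw [map_sum (A.mul (∑ i ∈ P, d i))]
    refine Finset.sum_congr rfl fun j hj => ?_
    rw [hPd, if_pos hj]
  have htr : A.tr (∑ i ∈ P, d i) = P.card := by
    rw [map_sum, Finset.sum_congr rfl fun j _ => A.tr_prim _ (hd.1 j)]
    simp
  obtain ⟨f', h1, h2, h3, h4⟩ := A.key_lemma s v hv _ hf (by rw [htr]; exact_mod_cast hlt)
  have h5 := A.ip_nonneg (A.idem_mem_sq h1) h
  rw [ip_sub_right, ip_sum_right, Finset.sum_eq_zero h4, ip_sum_right] at h5
  have hout : ∀ j, j ∉ P → A.ip f' (d j) = 0 := by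
    intro j hj
    have := A.mul_one_zero hf h3 (by rw [hPd, if_neg hj])
    unfold ip; rw [this, map_zero]
  have hnn : ∀ j, 0 ≤ A.ip f' (d j) := fun j => A.ip_idem_idem_nonneg h1 (A.frame_idem hd j)
  have hterm : ∀ j ∈ Finset.univ, 0 ≤ A.ip f' (l j • d j) := by
    intro j _
    rw [ip_smul_right]
    by_cases hj : j ∈ P
    · exact mul_nonneg (Finset.mem_filter.1 hj).2.le (hnn j)
    · rw [hout j hj, mul_zero]
  have hz := (Finset.sum_eq_zero_iff_of_nonneg hterm).1
    (le_antisymm (by linarith) (Finset.sum_nonneg hterm))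
  have hall : ∀ j, A.ip f' (d j) = 0 := by
    intro j
    by_cases hj : j ∈ P
    · have := hz j (Finset.mem_univ _)
      rw [ip_smul_right] at this
      exact (mul_eq_zero.1 this).resolve_left (Finset.mem_filter.1 hj).2.ne'
    · exact hout j hj
  have h6 : A.ip f' A.e = 0 := by
    rw [← A.frame_sum hd, ip_sum_right]
    exact Finset.sum_eq_zero fun j _ => hall j
  unfold ip at h6
  rw [A.mul_e] at h6
  exact (A.tau_idem_pos h1 h2).ne' h6

theorem pos_card_le (A : EJA J) {m n : ℕ} {c : Fin m → J} {d : Fin n → J} (hc : A.IsFrame c)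
    (hd : A.IsFrame d) (k : Fin m → ℝ) (l : Fin n → ℝ) {g : (J →L[ℝ] J)ˣ}
    (hg : g ∈ A.conePreserving)
    (h : (g : J →L[ℝ] J) (∑ j, k j • c j) = ∑ j, l j • d j) :
    (Finset.univ.filter fun j => 0 < l j).card ≤ (Finset.univ.filter fun j => 0 < k j).card := by
  refine A.card_le_of_dom hd l _ (fun j => (g : J →L[ℝ] J) (k j • c j)) (fun j hj => ?_) ?_
  · exact A.extr_map hg (A.smul_mem_extr (hc.1 j) (Finset.mem_filter.1 hj).2.le)
  · rw [← h, ← map_sum, ← map_sub]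
    apply A.conePreserving_sq hg
    have : ∑ j with 0 < k j, k j • c j - ∑ j, k j • c j = ∑ j, (max (-k j) 0) • c j := by
      rw [Finset.sum_filter, ← Finset.sum_sub_distrib]
      refine Finset.sum_congr rfl fun j _ => ?_
      split_ifs with hj
      · rw [max_eq_right (by linarith), sub_self, zero_smul]
      · rw [max_eq_left (by linarith), zero_sub, neg_smul]
    rw [this]
    exact A.sum_mem_sq hc fun i => le_max_right _ _

theorem pos_card_eq (A : EJA J) {m n : ℕ} {c : Fin m → J} {d : Fin n → J} (hc : A.IsFrame c)
    (hd : A.IsFrame d) (k : Fin m → ℝ) (l : Fin n → ℝ) {g : (J →L[ℝ] J)ˣ}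
    (hg : g ∈ A.conePreserving)
    (h : (g : J →L[ℝ] J) (∑ j, k j • c j) = ∑ j, l j • d j) :
    (Finset.univ.filter fun j => 0 < k j).card = (Finset.univ.filter fun j => 0 < l j).card := by
  refine le_antisymm ?_ (A.pos_card_le hc hd k l hg h)
  refine A.pos_card_le hd hc l k (A.conePreserving_inv hg) ?_
  rw [← h, units_inv_apply]

theorem neg_card_eq (A : EJA J) {m n : ℕ} {c : Fin m → J} {d : Fin n → J} (hc : A.IsFrame c)
    (hd : A.IsFrame d) (k : Fin m → ℝ) (l : Fin n → ℝ) {g : (J →L[ℝ] J)ˣ}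
    (hg : g ∈ A.conePreserving)
    (h : (g : J →L[ℝ] J) (∑ j, k j • c j) = ∑ j, l j • d j) :
    (Finset.univ.filter fun j => k j < 0).card = (Finset.univ.filter fun j => l j < 0).card := by
  have := A.pos_card_eq hc hd (fun j => - k j) (fun j => - l j) hg (by
    simp only [neg_smul, Finset.sum_neg_distrib, map_neg, h])
  simpa using this

end EJA

open scoped BigOperators Classical
set_option linter.unusedSectionVars false
namespace EJA

variable {J : Type} [NormedAddCommGroup J] [NormedSpace ℝ J] [FiniteDimensional ℝ J]

/-! ### Off-diagonal Peirce spaces -/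

theorem half_zero (A : EJA J) {m : ℕ} {c : Fin m → J} (hc : A.IsFrame c) {i j : Fin m}
    (hij : i ≠ j) {x : J} (hi : A.mul (c i) x = (1/2:ℝ) • x) (hj : A.mul (c j) x = (1/2:ℝ) • x)
    {k : Fin m} (hki : k ≠ i) (hkj : k ≠ j) : A.mul (c k) x = 0 := by
  apply A.ip_idem_zero (A.frame_idem hc k)
  have h1 : ∑ k, A.ip (A.mul (c k) x) x = A.ip x x := by
    rw [← ip_sum_left, A.frame_sum_mul hc]
  rw [← Finset.add_sum_erase _ _ (Finset.mem_univ i),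
    ← Finset.add_sum_erase _ _ (Finset.mem_erase.2 ⟨hij.symm, Finset.mem_univ j⟩), hi, hj,
    ip_smul_left] at h1
  have h2 : ∑ k ∈ (Finset.univ.erase i).erase j, A.ip (A.mul (c k) x) x = 0 := by linarith
  rw [Finset.sum_eq_zero_iff_of_nonneg
    (fun k _ => A.ip_idem_nonneg (A.frame_idem hc k) x)] at h2
  exact h2 k (by simp [hki, hkj])

theorem half_coeff (A : EJA J) {c x : J} (hc : A.IsPrimitive c) (hx : x ≠ 0)
    (h : A.mul c x = (1/2:ℝ) • x) : ∃ t : ℝ, 0 < t ∧ A.mul c (A.mul x x) = t • c := by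
  have hcc : A.mul c c = c := hc.1
  obtain ⟨t, ht⟩ := A.sum_smul_of_mul hc (A.mul_half_half hcc h)
  refine ⟨t, ?_, ht⟩
  have h1 : A.ip (A.mul c (A.mul x x)) c = (1/2) * A.ip x x := by
    rw [A.ip_mul, hcc, A.ip_mul, A.comm x c, h, ip_smul_right]
  rw [ht, ip_smul_left] at h1
  have h2 := A.ip_self_pos hx
  have h3 := A.ip_self_pos hc.2.1
  by_contra hneg
  push Not at hneg
  nlinarith

theorem half_sq (A : EJA J) {m : ℕ} {c : Fin m → J} (hc : A.IsFrame c) {i j : Fin m}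
    (hij : i ≠ j) {x : J} (hx : x ≠ 0) (hi : A.mul (c i) x = (1/2:ℝ) • x)
    (hj : A.mul (c j) x = (1/2:ℝ) • x) :
    ∃ s t : ℝ, 0 < s ∧ 0 < t ∧ A.mul x x = s • c i + t • c j := by
  obtain ⟨s, hs, hs'⟩ := A.half_coeff (hc.1 i) hx hi
  obtain ⟨t, ht, ht'⟩ := A.half_coeff (hc.1 j) hx hj
  refine ⟨s, t, hs, ht, ?_⟩
  rw [← A.frame_sum_mul hc (A.mul x x), ← Finset.add_sum_erase _ _ (Finset.mem_univ i),
    ← Finset.add_sum_erase _ _ (Finset.mem_erase.2 ⟨hij.symm, Finset.mem_univ j⟩), hs', ht',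
    Finset.sum_eq_zero, add_zero]
  intro k hk
  have hkj := (Finset.mem_erase.1 hk).1
  have hki := (Finset.mem_erase.1 (Finset.mem_erase.1 hk).2).1
  have h0 := A.half_zero hc hij hi hj hki hkj
  exact A.mul_zero_zero (A.frame_idem hc k) h0 h0

theorem half_trans (A : EJA J) {m : ℕ} {c : Fin m → J} (hc : A.IsFrame c) {i j k : Fin m}
    (hij : i ≠ j) (hjk : j ≠ k) (hik : i ≠ k) {x y : J} (hx : x ≠ 0) (hy : y ≠ 0)
    (hxi : A.mul (c i) x = (1/2:ℝ) • x) (hxj : A.mul (c j) x = (1/2:ℝ) • x)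
    (hyj : A.mul (c j) y = (1/2:ℝ) • y) (hyk : A.mul (c k) y = (1/2:ℝ) • y) :
    ∃ z : J, z ≠ 0 ∧ A.mul (c i) z = (1/2:ℝ) • z ∧ A.mul (c k) z = (1/2:ℝ) • z := by
  have hkx := A.half_zero hc hij hxi hxj hik.symm hjk.symm
  have hiy := A.half_zero hc hjk hyj hyk hij hik
  obtain ⟨s, t, hs, ht, hxx⟩ := A.half_sq hc hij hx hxi hxj
  obtain ⟨s', t', hs', ht', hyy⟩ := A.half_sq hc hjk hy hyj hyk
  refine ⟨A.mul x y, ?_, ?_, ?_⟩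
  · intro h0
    have h1 := A.lin1 x y (c k)
    have h2 : A.mul (A.mul x x) (c k) = 0 := by
      rw [A.comm]; exact A.mul_zero_zero (A.frame_idem hc k) hkx hkx
    rw [h0, h2, A.comm y (c k), hyk] at h1
    simp only [map_zero, LinearMap.zero_apply, smul_zero, add_zero, zero_add, map_smul] at h1
    have h3 : A.mul (A.mul x x) y = 0 := by
      rcases smul_eq_zero.1 h1.symm with h | h
      · norm_num at h
      · exact h
    have h4 : A.ip (A.mul y y) (A.mul x x) = 0 := by
      rw [A.ip_mul, A.comm y, h3, ip_zero_right]
    have o1 : A.ip (c j) (c i) = 0 := by unfold ip; rw [A.frame_mul hc, if_neg hij.symm, map_zero]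
    have o2 : A.ip (c k) (c i) = 0 := by unfold ip; rw [A.frame_mul hc, if_neg hik.symm, map_zero]
    have o3 : A.ip (c k) (c j) = 0 := by unfold ip; rw [A.frame_mul hc, if_neg hjk.symm, map_zero]
    rw [hxx, hyy] at h4
    simp only [ip_add_left, ip_add_right, ip_smul_left, ip_smul_right, o1, o2, o3] at h4
    have := A.ip_self_pos (A.frame_ne hc j)
    have h5 : 0 < s' * (t * A.ip (c j) (c j)) := by positivity
    nlinarith
  · rw [A.comm x y, A.comm_of_orth (A.frame_idem hc i) hiy, hxi, map_smul]
  · rw [A.comm_of_orth (A.frame_idem hc k) hkx, hyk, map_smul]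

theorem mul_mul_half (A : EJA J) {c d : J} (hc : A.mul c c = c) (hcd : A.mul c d = 0) (z : J) :
    A.mul c (A.mul c (A.mul d z)) = (1/2:ℝ) • A.mul c (A.mul d z) := by
  have h := A.lin3 c d c z
  have h1 := A.comm_of_orth hc hcd (A.mul c z)
  have h2 := A.comm_of_orth hc hcd z
  rw [hcd, A.comm d c, hcd, hc] at h
  simp only [map_zero, LinearMap.zero_apply, add_zero, zero_add] at h
  rw [← h1, ← h2] at h
  linear_combination (norm := module) (1/2:ℝ) • h

theorem exists_half (A : EJA J) {m : ℕ} {c : Fin m → J} (hc : A.IsFrame c) {i j : Fin m}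
    (hij : i ≠ j) :
    ∃ x : J, x ≠ 0 ∧ A.mul (c i) x = (1/2:ℝ) • x ∧ A.mul (c j) x = (1/2:ℝ) • x := by
  by_contra hno
  set S := Finset.univ.filter fun k => k = i ∨ ∃ x : J, x ≠ 0 ∧ A.mul (c i) x = (1/2:ℝ) • x ∧
    A.mul (c k) x = (1/2:ℝ) • x with hS
  have hiS : i ∈ S := by simp [hS]
  have hjS : j ∉ S := by
    intro h
    rcases (Finset.mem_filter.1 h).2 with h | h
    · exact hij h.symm
    · exact hno h
  have hzero : ∀ a ∈ S, ∀ k, k ∉ S → ∀ y, A.mul (c a) (A.mul (c k) y) = 0 := by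
    intro a ha k hk y
    by_contra hne
    have hak : a ≠ k := fun h => hk (h ▸ ha)
    have hoak : A.mul (c a) (c k) = 0 := by rw [A.frame_mul hc, if_neg hak]
    have hoka : A.mul (c k) (c a) = 0 := by rw [A.comm, hoak]
    have e1 := A.mul_mul_half (A.frame_idem hc a) hoak y
    have e2 : A.mul (c k) (A.mul (c a) (A.mul (c k) y))
        = (1/2:ℝ) • A.mul (c a) (A.mul (c k) y) := by
      rw [A.comm_of_orth (A.frame_idem hc a) hoak]
      exact A.mul_mul_half (A.frame_idem hc k) hoka y
    apply hk
    refine Finset.mem_filter.2 ⟨Finset.mem_univ _, Or.inr ?_⟩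
    rcases (Finset.mem_filter.1 ha).2 with h | ⟨x, hx, hxi, hxa⟩
    · subst h
      exact ⟨_, hne, e1, e2⟩
    · by_cases hai : a = i
      · subst hai
        exact ⟨_, hne, e1, e2⟩
      · have hik : i ≠ k := fun h => hk (h ▸ hiS)
        exact A.half_trans hc (Ne.symm hai) hak hik hx hne hxi hxa e1 e2
  set f := ∑ a ∈ S, c a with hf
  have hfc : ∀ k, A.mul f (c k) = if k ∈ S then c k else 0 := by
    intro k
    rw [hf, map_sum, LinearMap.sum_apply]
    simp only [A.frame_mul hc]
    simp
  have hff : A.mul f f = f := by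
    conv_lhs => rw [hf]
    rw [← hf, map_sum]
    refine Finset.sum_congr rfl fun k hk => ?_
    rw [hfc, if_pos hk]
  have hcompl : A.e - f = ∑ k ∈ Sᶜ, c k := by
    rw [← A.frame_sum hc, hf, ← Finset.sum_add_sum_compl S, add_sub_cancel_left]
  have hff' : ∀ y, A.mul f (A.mul f y) = A.mul f y := by
    intro y
    have h1 : A.mul f (A.mul (A.e - f) y) = 0 := by
      have h2 : A.mul (∑ k ∈ Sᶜ, c k) y = ∑ k ∈ Sᶜ, A.mul (c k) y := by
        rw [map_sum, LinearMap.sum_apply]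
      rw [hcompl, h2, map_sum (A.mul f)]
      refine Finset.sum_eq_zero fun k hk => ?_
      rw [hf, map_sum, LinearMap.sum_apply]
      exact Finset.sum_eq_zero fun a ha => hzero a ha k (Finset.mem_compl.1 hk) y
    rw [map_sub A.mul, LinearMap.sub_apply, A.unit_mul, map_sub, sub_eq_zero] at h1
    exact h1.symm
  let I : Submodule ℝ J := LinearMap.ker (A.mul f - LinearMap.id)
  have hI : ∀ x, x ∈ I ↔ A.mul f x = x := by
    intro x
    simp [I, sub_eq_zero]
  rcases A.simple I (fun x hx y => by
    rw [hI] at hx ⊢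
    have h0 : A.mul f (y - A.mul f y) = 0 := by rw [map_sub, hff', sub_self]
    have h1 := A.mul_one_zero hff hx h0
    rw [map_sub, sub_eq_zero] at h1
    rw [A.comm y x, h1]
    exact A.mul_one_one hff hx (hff' y)) with h | h
  · have : c i ∈ I := by rw [hI, hfc, if_pos hiS]
    rw [h, Submodule.mem_bot] at this
    exact A.frame_ne hc i this
  · have : c j ∈ I := by rw [h]; trivial
    rw [hI, hfc, if_neg hjS] at this
    exact A.frame_ne hc j this.symm

end EJA

open scoped BigOperators Classical
set_option linter.unusedSectionVars false
namespace EJA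

variable {J : Type} [NormedAddCommGroup J] [NormedSpace ℝ J] [FiniteDimensional ℝ J]

/-! ### The automorphism group is compact -/

theorem ip_lower (A : EJA J) : ∃ m : ℝ, 0 < m ∧ ∀ x, m * ‖x‖ ^ 2 ≤ A.ip x x := by
  have hcont : Continuous fun x : J => A.ip x x :=
    A.continuous_ip.comp (continuous_id.prodMk continuous_id)
  have _ : ProperSpace J := FiniteDimensional.proper ℝ J
  rcases subsingleton_or_nontrivial J with hJ | hJ
  · refine ⟨1, one_pos, fun x => ?_⟩
    rw [Subsingleton.elim x 0]
    simp [ip_zero_left]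
  · obtain ⟨x0, hx0, hmin⟩ := (isCompact_sphere (0:J) 1).exists_isMinOn
      (NormedSpace.sphere_nonempty.2 zero_le_one) hcont.continuousOn
    have hx0' : x0 ≠ 0 := by
      rintro rfl
      simp at hx0
    refine ⟨A.ip x0 x0, A.ip_self_pos hx0', fun x => ?_⟩
    by_cases hx : x = 0
    · simp [hx, ip_zero_left]
    have hn : 0 < ‖x‖ := norm_pos_iff.2 hx
    have h1 : ‖x‖⁻¹ • x ∈ Metric.sphere (0:J) 1 := by
      rw [mem_sphere_zero_iff_norm, norm_smul, norm_inv, norm_norm, inv_mul_cancel₀ hn.ne']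
    have h2 : A.ip x0 x0 ≤ A.ip (‖x‖⁻¹ • x) (‖x‖⁻¹ • x) := hmin h1
    rw [ip_smul_left, ip_smul_right] at h2
    calc A.ip x0 x0 * ‖x‖ ^ 2 ≤ (‖x‖⁻¹ * (‖x‖⁻¹ * A.ip x x)) * ‖x‖ ^ 2 := by gcongr
      _ = A.ip x x := by field_simp

theorem ip_upper (A : EJA J) : ∃ M : ℝ, 0 < M ∧ ∀ x, A.ip x x ≤ M * ‖x‖ ^ 2 := by
  have hcont : Continuous fun x : J => A.ip x x :=
    A.continuous_ip.comp (continuous_id.prodMk continuous_id)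
  have _ : ProperSpace J := FiniteDimensional.proper ℝ J
  obtain ⟨C, hC⟩ := (isCompact_sphere (0:J) 1).exists_bound_of_continuousOn hcont.continuousOn
  refine ⟨max C 1, by positivity, fun x => ?_⟩
  by_cases hx : x = 0
  · simp [hx, ip_zero_left]
  have hn : 0 < ‖x‖ := norm_pos_iff.2 hx
  have h1 : ‖x‖⁻¹ • x ∈ Metric.sphere (0:J) 1 := by
    rw [mem_sphere_zero_iff_norm, norm_smul, norm_inv, norm_norm, inv_mul_cancel₀ hn.ne']
  have h2 := (le_abs_self _).trans (hC _ h1)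
  rw [ip_smul_left, ip_smul_right] at h2
  calc A.ip x x = (‖x‖⁻¹ * (‖x‖⁻¹ * A.ip x x)) * ‖x‖ ^ 2 := by field_simp
    _ ≤ C * ‖x‖ ^ 2 := by gcongr
    _ ≤ max C 1 * ‖x‖ ^ 2 := by gcongr; exact le_max_left _ _

theorem isClosed_autSet (A : EJA J) : IsClosed A.autSet := by
  have ev : ∀ x : J, Continuous fun g : J →L[ℝ] J => g x := fun x =>
    (ContinuousLinearMap.apply ℝ J x).continuous
  have h : A.autSet = (⋂ x, ⋂ y, {g | g (A.mul x y) = A.mul (g x) (g y)}) ∩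
      (⋂ x, ⋂ y, {g | A.ip (g x) (g y) = A.ip x y}) := by
    ext g
    simp only [autSet, Set.mem_inter_iff, Set.mem_iInter, Set.mem_ofPred_eq]
  rw [h]
  refine IsClosed.inter ?_ ?_
  · exact isClosed_iInter fun x => isClosed_iInter fun y =>
      isClosed_eq (ev _) (A.continuous_mul.comp ((ev x).prodMk (ev y)))
  · exact isClosed_iInter fun x => isClosed_iInter fun y =>
      isClosed_eq (A.continuous_ip.comp ((ev x).prodMk (ev y))) continuous_const

theorem isCompact_autSet (A : EJA J) : IsCompact A.autSet := by
  have _ : ProperSpace (J →L[ℝ] J) := FiniteDimensional.proper ℝ (J →L[ℝ] J)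
  obtain ⟨m, hm, hm'⟩ := A.ip_lower
  obtain ⟨M, hM, hM'⟩ := A.ip_upper
  refine Metric.isCompact_of_isClosed_isBounded A.isClosed_autSet ?_
  refine (Metric.isBounded_closedBall (x := (0 : J →L[ℝ] J)) (r := Real.sqrt (M / m))).subset ?_
  intro g hg
  rw [mem_closedBall_zero_iff]
  refine g.opNorm_le_bound (Real.sqrt_nonneg _) fun x => ?_
  have h1 := hm' (g x)
  rw [hg.2] at h1
  have h2 := h1.trans (hM' x)
  have h3 : ‖g x‖ ^ 2 ≤ M / m * ‖x‖ ^ 2 := by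
    rw [div_mul_eq_mul_div, le_div_iff₀ hm]; linarith
  have h4 := Real.sqrt_le_sqrt h3
  rwa [Real.sqrt_sq (norm_nonneg _), Real.sqrt_mul (by positivity),
    Real.sqrt_sq (norm_nonneg _)] at h4

theorem one_mem_autSet (A : EJA J) : (1 : J →L[ℝ] J) ∈ A.autSet :=
  ⟨fun _ _ => rfl, fun _ _ => rfl⟩

theorem mul_mem_autSet (A : EJA J) {g h : J →L[ℝ] J} (hg : g ∈ A.autSet) (hh : h ∈ A.autSet) :
    g * h ∈ A.autSet := by
  refine ⟨fun x y => ?_, fun x y => ?_⟩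
  · simp only [mul_apply_eq_comp, hh.1, hg.1]
  · simp only [mul_apply_eq_comp, hg.2, hh.2]

/-- Identity component of the automorphism group. -/
def KK (A : EJA J) : Set (J →L[ℝ] J) := connectedComponentIn A.autSet 1

theorem KK_subset (A : EJA J) : A.KK ⊆ A.autSet := connectedComponentIn_subset _ _

theorem one_mem_KK (A : EJA J) : 1 ∈ A.KK := mem_connectedComponentIn A.one_mem_autSet

theorem isCompact_KK (A : EJA J) : IsCompact A.KK :=
  A.isCompact_autSet.of_isClosed_subset (isClosed_of_closure_subset
    (IsPreconnected.subset_connectedComponentIn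
      (isPreconnected_connectedComponentIn (F := A.autSet) (x := 1)).closure
      (subset_closure A.one_mem_KK)
      (closure_minimal A.KK_subset A.isClosed_autSet))) A.KK_subset

theorem isPreconnected_KK (A : EJA J) : IsPreconnected A.KK := isPreconnected_connectedComponentIn

theorem exp_mul_mem_KK (A : EJA J) {k : J →L[ℝ] J} (hk : k ∈ A.KK) (u v : J) (t : ℝ) :
    NormedSpace.exp (t • A.inn u v) * k ∈ A.KK := by
  have hpre : IsPreconnected (Set.range fun t : ℝ => NormedSpace.exp (t • A.inn u v) * k) :=
    isPreconnected_range ((cexp_continuous _).mul continuous_const)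
  have hsub : (Set.range fun t : ℝ => NormedSpace.exp (t • A.inn u v) * k) ⊆ A.autSet := by
    rintro _ ⟨s, rfl⟩
    exact A.mul_mem_autSet (A.exp_inn_mem u v s) (A.KK_subset hk)
  have hmem : k ∈ Set.range fun t : ℝ => NormedSpace.exp (t • A.inn u v) * k :=
    ⟨0, by simp only [cexp_zero, one_mul]⟩
  have h1 := hpre.subset_connectedComponentIn hmem hsub
  unfold KK at hk ⊢
  rw [connectedComponentIn_eq hk]
  exact h1 ⟨t, rfl⟩

theorem second_order {f f' : ℝ → ℝ} {f2 : ℝ} (h1 : ∀ t, HasDerivAt f (f' t) t)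
    (h2 : HasDerivAt f' f2 0) (hmax : ∀ t, f t ≤ f 0) : f' 0 = 0 ∧ f2 ≤ 0 := by
  have hloc : IsLocalMax f 0 := Filter.Eventually.of_forall hmax
  have e1 : deriv f = f' := funext fun t => (h1 t).deriv
  have h0 : f' 0 = 0 := hloc.hasDerivAt_eq_zero (h1 0)
  refine ⟨h0, ?_⟩
  by_contra hpos
  push Not at hpos
  have e2 : deriv (deriv f) 0 = f2 := by rw [e1, h2.deriv]
  have hmin : IsLocalMin f 0 := isLocalMin_of_deriv_deriv_pos (by rw [e2]; exact hpos)
    (by rw [e1, h0]) (h1 0).continuousAt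
  have hconst : f =ᶠ[nhds 0] fun _ => f 0 := by
    filter_upwards [hmin] with t ht
    exact le_antisymm (hmax t) ht
  have h3 : deriv (deriv f) 0 = 0 := by
    rw [(hconst.deriv).deriv_eq]
    simp
  linarith

theorem aut_inj (A : EJA J) {k : J →L[ℝ] J} (hk : k ∈ A.autSet) : Function.Injective k := by
  rw [injective_iff_map_eq_zero]
  intro x hx
  apply A.ip_self_eq_zero
  rw [← hk.2, hx, ip_zero_left]

theorem aut_surj (A : EJA J) {k : J →L[ℝ] J} (hk : k ∈ A.autSet) : Function.Surjective k :=
  LinearMap.injective_iff_surjective (f := k.toLinearMap) |>.1 (A.aut_inj hk)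

theorem aut_e (A : EJA J) {k : J →L[ℝ] J} (hk : k ∈ A.autSet) : k A.e = A.e := by
  obtain ⟨y, hy⟩ := A.aut_surj hk A.e
  have h := hk.1 A.e y
  rw [A.unit_mul, hy, A.mul_e] at h
  exact h.symm

theorem aut_frame (A : EJA J) {k : J →L[ℝ] J} (hk : k ∈ A.autSet) {m : ℕ} {c : Fin m → J}
    (hc : A.IsFrame c) : A.IsFrame fun j => k (c j) := by
  refine ⟨fun j => ⟨?_, ?_, ?_⟩, fun i j hij => ?_, ?_⟩
  · show A.mul (k (c j)) (k (c j)) = k (c j)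
    rw [← hk.1, A.frame_idem hc]
  · intro h
    exact A.frame_ne hc j (A.aut_inj hk (h.trans (map_zero k).symm))
  · intro d hd hcd
    obtain ⟨y, rfl⟩ := A.aut_surj hk d
    have hd' : A.mul (k y) (k y) = k y := hd
    rw [← hk.1] at hd' hcd
    rcases (hc.1 j).2.2 y (A.aut_inj hk hd') (A.aut_inj hk hcd) with h | h
    · left; rw [h, map_zero]
    · right; rw [h]
  · show A.mul (k (c i)) (k (c j)) = 0
    rw [← hk.1, A.frame_mul hc, if_neg hij, map_zero]
  · rw [← map_sum, A.frame_sum hc, A.aut_e hk]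

/-- Two commuting elements: eigenvectors. -/
theorem frame_eig (A : EJA J) {m : ℕ} {c : Fin m → J} (hc : A.IsFrame c) {α : Fin m → ℝ}
    (hα : StrictAnti α) {b : J}
    (hcomm : ∀ u, A.mul (∑ j, α j • c j) (A.mul b u) = A.mul b (A.mul (∑ j, α j • c j) u))
    (i : Fin m) : ∃ γ : ℝ, A.mul b (c i) = γ • c i := by
  induction i using WellFoundedLT.induction with
  | _ i ih =>
  set y := A.mul b (c i) with hy
  have hay : A.mul (∑ j, α j • c j) y = α i • y := by
    rw [hy, hcomm, A.comm _ (c i), A.frame_mul_sum hc, map_smul]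
  have hlt : ∀ j, j < i → A.mul (c j) y = 0 := by
    intro j hj
    obtain ⟨γ, hγ⟩ := ih j hj
    have h0 : A.mul (c j) (b - γ • c j) = 0 := by
      rw [map_sub, A.comm, hγ, map_smul, A.frame_idem hc, sub_self]
    have hji : A.mul (c j) (c i) = 0 := by rw [A.frame_mul hc, if_neg hj.ne]
    have h1 := A.comm_of_orth (A.frame_idem hc j) h0 (c i)
    rw [hji, map_zero, map_sub, LinearMap.sub_apply, map_smul, LinearMap.smul_apply, hji,
      smul_zero, sub_zero] at h1
    exact h1
  have hsum : ∑ j, (α i - α j) * A.ip (A.mul (c j) y) y = 0 := by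
    have h1 : A.ip (A.mul (∑ j, α j • c j) y) y = ∑ j, α j * A.ip (A.mul (c j) y) y := by
      rw [map_sum, LinearMap.sum_apply, ip_sum_left]
      refine Finset.sum_congr rfl fun j _ => ?_
      rw [map_smul, LinearMap.smul_apply, ip_smul_left]
    have h2 : A.ip y y = ∑ j, A.ip (A.mul (c j) y) y := by
      rw [← ip_sum_left, A.frame_sum_mul hc]
    rw [hay, ip_smul_left, h2] at h1
    simp only [sub_mul, Finset.sum_sub_distrib, ← Finset.mul_sum]
    linarith
  have hterm : ∀ j ∈ Finset.univ, 0 ≤ (α i - α j) * A.ip (A.mul (c j) y) y := by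
    intro j _
    rcases lt_trichotomy j i with h | h | h
    · rw [hlt j h, ip_zero_left, mul_zero]
    · rw [h, sub_self, zero_mul]
    · exact mul_nonneg (sub_nonneg.2 (hα h).le) (A.ip_idem_nonneg (A.frame_idem hc j) y)
  rw [Finset.sum_eq_zero_iff_of_nonneg hterm] at hsum
  have hne : ∀ j, j ≠ i → A.mul (c j) y = 0 := by
    intro j hj
    rcases lt_or_gt_of_ne hj with h | h
    · exact hlt j h
    · have h1 := (mul_eq_zero.1 (hsum j (Finset.mem_univ _))).resolve_left
        (sub_pos.2 (hα h)).ne'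
      exact A.ip_idem_zero (A.frame_idem hc j) h1
  have hone : A.mul (c i) y = y := by
    conv_rhs => rw [← A.frame_sum_mul hc y]
    rw [Finset.sum_eq_single i (fun j _ hj => hne j hj) (by simp)]
  exact A.sum_smul_of_mul (hc.1 i) hone

theorem inn_frame (A : EJA J) {m : ℕ} {d : Fin m → J} (hd : A.IsFrame d) {p q : Fin m}
    (hpq : p ≠ q) {x : J} (hp : A.mul (d p) x = (1/2:ℝ) • x) (hq : A.mul (d q) x = (1/2:ℝ) • x)
    (l : Fin m → ℝ) : A.inn (d p) x (∑ j, l j • d j) = ((l q - l p) / 4) • x := by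
  rw [map_sum, ← Finset.add_sum_erase _ _ (Finset.mem_univ p),
    ← Finset.add_sum_erase _ _ (Finset.mem_erase.2 ⟨hpq.symm, Finset.mem_univ q⟩),
    Finset.sum_eq_zero, add_zero]
  · simp only [map_smul, inn_apply]
    rw [A.comm x (d p), A.comm x (d q), hp, hq, A.frame_idem hd, A.frame_mul hd, if_neg hpq,
      map_smul, hp, A.comm x (d p), hp, map_zero]
    module
  · intro k hk
    have hkq := (Finset.mem_erase.1 hk).1
    have hkp := (Finset.mem_erase.1 (Finset.mem_erase.1 hk).2).1
    have h0 := A.half_zero hd hpq hp hq hkp hkq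
    rw [map_smul, inn_apply, A.comm x (d k), h0, A.frame_mul hd, if_neg hkp.symm, map_zero, map_zero,
      sub_zero, smul_zero]

theorem frame_conj (A : EJA J) {m : ℕ} {c d : Fin m → J} (hc : A.IsFrame c) (hd : A.IsFrame d) :
    ∃ k ∈ A.KK, ∀ j, k (c j) = d j := by
  let α : Fin m → ℝ := fun j => -((j : ℕ) : ℝ)
  have hα : StrictAnti α := by
    intro i j hij
    have : ((i : ℕ) : ℝ) < ((j : ℕ) : ℝ) := by exact_mod_cast hij
    simp only [α]; linarith
  set a := ∑ j, α j • c j with ha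
  set b := ∑ j, α j • d j with hb
  have hcont : Continuous fun k : J →L[ℝ] J => A.ip (k a) b :=
    A.continuous_ip.comp
      (((ContinuousLinearMap.apply ℝ J a).continuous).prodMk continuous_const)
  obtain ⟨k, hk, hmax⟩ := A.isCompact_KK.exists_isMaxOn ⟨1, A.one_mem_KK⟩ hcont.continuousOn
  have hka := A.KK_subset hk
  have hc' := A.aut_frame hka hc
  have hka' : k a = ∑ j, α j • k (c j) := by
    rw [ha, map_sum]; simp only [map_smul]
  -- first and second order conditions
  have hder : ∀ u v, A.ip (A.inn u v (k a)) b = 0 ∧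
      0 ≤ A.ip (A.inn u v (k a)) (A.inn u v b) := by
    intro u v
    set D := A.inn u v with hD
    have hE : ∀ (w : J) (t : ℝ), HasDerivAt (fun t : ℝ => A.ip (NormedSpace.exp (t • D) w) b)
        (A.ip (NormedSpace.exp (t • D) (D w)) b) t := by
      intro w t
      have h1 := (hasDerivAt_exp_smul_const (𝕂 := ℝ) D t).clm_apply (hasDerivAt_const t w)
      let φ : J →L[ℝ] ℝ := LinearMap.toContinuousLinearMap (A.tau ∘ₗ A.mul b)
      have h2 := φ.hasFDerivAt.comp_hasDerivAt t h1
      have h3 : ∀ z, φ z = A.ip z b := fun z => by rw [ip_comm]; rfl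
      have h4 := h2.congr_deriv (g' := A.ip (NormedSpace.exp (t • D) (D w)) b) (by
        rw [h3]; simp)
      refine h4.congr_of_eventuallyEq (Filter.Eventually.of_forall fun s => ?_)
      exact (h3 _).symm
    have h := second_order (hE (k a)) (hE (D (k a)) 0) (fun t => by
      have := hmax (A.exp_mul_mem_KK hk u v t)
      simpa [NormedSpace.exp_zero] using this)
    simp only [zero_smul, NormedSpace.exp_zero, one_apply_eq_self] at h
    refine ⟨h.1, ?_⟩
    have h2 := h.2
    rw [hD, ip_inn, ← hD] at h2
    linarith
  have hcomm : ∀ u, A.mul (k a) (A.mul b u) = A.mul b (A.mul (k a) u) := by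
    intro u
    rw [← sub_eq_zero]
    apply A.ip_self_eq_zero
    set v := A.mul (k a) (A.mul b u) - A.mul b (A.mul (k a) u) with hv
    have h := (hder u v).1
    have e1 : A.ip (A.mul u (A.mul v (k a))) b = A.ip v (A.mul (k a) (A.mul b u)) := by
      rw [A.ip_mul, A.comm v (k a), A.ip_mul, A.comm u b]
    have e2 : A.ip (A.mul v (A.mul u (k a))) b = A.ip v (A.mul b (A.mul (k a) u)) := by
      rw [A.comm v, A.ip_mul, A.comm _ b, A.comm u (k a)]
    rw [inn_apply, ip_sub_left, e1, e2, ← ip_sub_right, ← hv] at h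
    exact h
  have hcomm' := hcomm
  rw [hka'] at hcomm'
  have heig := A.frame_eig hc' hα hcomm'
  have hex : ∀ i, ∃ j, k (c i) = d j := by
    intro i
    obtain ⟨γ, hγ⟩ := heig i
    have hi : A.mul (k (c i)) (k (c i)) = k (c i) := A.frame_idem hc' i
    have hi0 : k (c i) ≠ 0 := A.frame_ne hc' i
    have h1 : ∀ j, A.ip (k (c i)) (d j) ≠ 0 → α j = γ := by
      intro j hj
      have h2 : A.ip (A.mul b (k (c i))) (d j) = α j * A.ip (k (c i)) (d j) := by
        rw [A.ip_mul, A.comm b, hb, A.frame_mul_sum hd, ip_smul_right]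
      rw [hγ, ip_smul_left] at h2
      exact (mul_right_cancel₀ hj h2).symm
    have h3 : ∃ j, A.ip (k (c i)) (d j) ≠ 0 := by
      by_contra hno
      push Not at hno
      have h4 : A.ip (k (c i)) A.e = 0 := by
        rw [← A.frame_sum hd, ip_sum_right]
        exact Finset.sum_eq_zero fun j _ => hno j
      unfold ip at h4
      rw [A.mul_e] at h4
      exact (A.tau_idem_pos hi hi0).ne' h4
    obtain ⟨j, hj⟩ := h3
    refine ⟨j, ?_⟩
    have h5 : ∀ j', j' ≠ j → A.mul (d j') (k (c i)) = 0 := by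
      intro j' hj'
      rw [A.comm]
      apply A.ip_idem_idem_zero hi (A.frame_idem hd j')
      by_contra hne
      exact hj' (hα.injective ((h1 j' hne).trans (h1 j hj).symm))
    have h6 : A.mul (d j) (k (c i)) = k (c i) := by
      conv_rhs => rw [← A.frame_sum_mul hd (k (c i))]
      rw [Finset.sum_eq_single j (fun j' _ hj' => h5 j' hj') (by simp)]
    exact ((hd.1 j).2.2 _ hi h6).resolve_left hi0
  choose σ hσ using hex
  have hinj : Function.Injective σ := by
    intro i j hij
    by_contra hne
    have h1 := A.frame_mul hc' i j
    rw [if_neg hne] at h1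
    simp only [hσ, hij, A.frame_idem hd] at h1
    exact A.frame_ne hd _ h1
  have hbij : Function.Bijective σ := Finite.injective_iff_bijective.1 hinj
  let τ : Fin m ≃ Fin m := Equiv.ofBijective σ hbij
  have hτ : ∀ i, τ i = σ i := fun _ => rfl
  have hkad : k a = ∑ j, α (τ.symm j) • d j := by
    rw [hka', ← Equiv.sum_comp τ (fun j => α (τ.symm j) • d j)]
    refine Finset.sum_congr rfl fun i _ => ?_
    rw [Equiv.symm_apply_apply, hτ, hσ]
  have hmono : StrictMono σ := by
    intro i j hij
    have hne : σ i ≠ σ j := fun h => hij.ne (hinj h)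
    obtain ⟨x, hx, hp, hq⟩ := A.exists_half hd hne
    have h := (hder (d (σ i)) x).2
    rw [hkad, hb, A.inn_frame hd hne hp hq, A.inn_frame hd hne hp hq, ip_smul_left, ip_smul_right,
      ← hτ, ← hτ, Equiv.symm_apply_apply, Equiv.symm_apply_apply, hτ, hτ] at h
    have hxx := A.ip_self_pos hx
    have h1 := hα hij
    refine lt_of_le_of_ne ?_ hne
    by_contra hlt
    push Not at hlt
    have h2 := hα hlt
    have h3 : 0 < (α i - α j) * (α (σ j) - α (σ i)) * A.ip x x :=
      mul_pos (mul_pos (by linarith) (by linarith)) hxx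
    nlinarith
  have hid : σ = id := funext fun j => le_antisymm (hmono.apply_le) (hmono.le_apply)
  refine ⟨k, hk, fun j => ?_⟩
  rw [hσ, hid, id]

end EJA

open scoped BigOperators Classical
set_option linter.unusedSectionVars false
namespace EJA

variable {J : Type} [NormedAddCommGroup J] [NormedSpace ℝ J] [FiniteDimensional ℝ J]

/-! ### Assembly -/

theorem mem_Lgroup_of_preconnected (A : EJA J) {S : Set (J →L[ℝ] J)} (hS : IsPreconnected S)
    (h1 : (1 : J →L[ℝ] J) ∈ S) (hu : ∀ T ∈ S, ∃ u ∈ A.conePreserving, (u : J →L[ℝ] J) = T)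
    {g : (J →L[ℝ] J)ˣ} (hg : (g : J →L[ℝ] J) ∈ S) : g ∈ A.Lgroup := by
  have _ : CompleteSpace J := FiniteDimensional.complete ℝ J
  have key : ∀ u : (J →L[ℝ] J)ˣ, (u : J →L[ℝ] J) ∈ S → u ∈ A.conePreserving := by
    intro u h
    obtain ⟨v, hv, hvu⟩ := hu _ h
    rwa [← Units.ext hvu]
  let S' : Set (J →L[ℝ] J)ˣ := Units.val ⁻¹' S
  have hS' : IsPreconnected S' := by
    rw [← (Units.isOpenEmbedding_val (R := J →L[ℝ] J)).isInducing.isPreconnected_image]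
    have : Units.val '' S' = S := by
      ext T
      constructor
      · rintro ⟨u, h, rfl⟩
        exact h
      · intro h
        obtain ⟨u, _, rfl⟩ := hu T h
        exact ⟨u, h, rfl⟩
    rwa [this]
  let S'' : Set A.conePreserving := Subtype.val ⁻¹' S'
  have hS'' : IsPreconnected S'' := by
    rw [← Topology.IsInducing.subtypeVal.isPreconnected_image]
    have : Subtype.val '' S'' = S' := by
      ext u
      constructor
      · rintro ⟨v, h, rfl⟩
        exact h
      · intro h
        exact ⟨⟨u, key u h⟩, h, rfl⟩
    rwa [this]
  refine ⟨key g hg, ?_⟩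
  refine hS''.subset_connectedComponent (x := ⟨1, A.one_mem_conePreserving⟩) ?_ ?_
  · show ((1 : (J →L[ℝ] J)ˣ) : J →L[ℝ] J) ∈ S
    simpa using h1
  · exact hg

theorem aut_unit (A : EJA J) {k : J →L[ℝ] J} (hk : k ∈ A.autSet) :
    ∃ u ∈ A.conePreserving, (u : J →L[ℝ] J) = k := by
  let e : J ≃ₗ[ℝ] J := LinearEquiv.ofBijective (k : J →ₗ[ℝ] J) ⟨A.aut_inj hk, A.aut_surj hk⟩
  let u : (J →L[ℝ] J)ˣ := (ContinuousLinearEquiv.unitsEquiv ℝ J).symm e.toContinuousLinearEquiv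
  have huk : (u : J →L[ℝ] J) = k := by
    ext x
    rfl
  refine ⟨u, A.mem_conePreserving ?_ ?_, huk⟩
  · rintro x ⟨y, rfl⟩
    exact ⟨k y, by rw [huk, hk.1]⟩
  · rintro x ⟨y, rfl⟩
    obtain ⟨z, rfl⟩ := A.aut_surj hk y
    refine ⟨z, ?_⟩
    rw [← hk.1, ← huk, units_inv_apply]

theorem conePreserving_mul (A : EJA J) {g h : (J →L[ℝ] J)ˣ} (hg : g ∈ A.conePreserving)
    (hh : h ∈ A.conePreserving) : g * h ∈ A.conePreserving := by
  refine A.mem_conePreserving (fun x hx => ?_) (fun x hx => ?_)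
  · exact A.conePreserving_sq hg (A.conePreserving_sq hh hx)
  · rw [mul_inv_rev]
    exact A.conePreserving_sq (A.conePreserving_inv hh)
      (A.conePreserving_sq (A.conePreserving_inv hg) hx)

theorem exp_mul_mem_Lgroup (A : EJA J) (z : J) {k : J →L[ℝ] J} (hk : k ∈ A.KK) :
    ∃ g ∈ A.Lgroup, (g : J →L[ℝ] J) = NormedSpace.exp (A.Lc z) * k := by
  obtain ⟨u, hu, rfl⟩ := A.aut_unit (A.KK_subset hk)
  let φ : ℝ × (J →L[ℝ] J) → (J →L[ℝ] J) := fun p => NormedSpace.exp (p.1 • A.Lc z) * p.2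
  have hφ : Continuous φ :=
    ((cexp_continuous (A.Lc z)).comp continuous_fst).mul continuous_snd
  have hpre : IsPreconnected (φ '' (Set.univ ×ˢ A.KK)) :=
    (isPreconnected_univ.prod A.isPreconnected_KK).image φ hφ.continuousOn
  refine ⟨expU (A.Lc z) * u, A.mem_Lgroup_of_preconnected hpre ?_ ?_ ?_, rfl⟩
  · refine ⟨(0, 1), ⟨Set.mem_univ _, A.one_mem_KK⟩, ?_⟩
    simp only [φ, zero_smul, NormedSpace.exp_zero, mul_one]
  · rintro T ⟨⟨t, k⟩, ⟨_, hk⟩, rfl⟩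
    obtain ⟨v, hv, hvk⟩ := A.aut_unit (A.KK_subset hk)
    refine ⟨expU (A.Lc (t • z)) * v, A.conePreserving_mul (A.expU_mem _) hv, ?_⟩
    simp only [φ]
    rw [Units.val_mul, hvk, map_smul]
    rfl
  · refine ⟨(1, u), ⟨Set.mem_univ _, hk⟩, ?_⟩
    simp only [φ, one_smul]
    rfl

/-- coefficients of `e_{p,q}` -/
noncomputable def eps {m : ℕ} (p q : ℕ) (j : Fin m) : ℝ :=
  if (j : ℕ) < p then (1 : ℝ) else if (j : ℕ) < p + q then -1 else 0

theorem card_lt {m n : ℕ} (h : n ≤ m) :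
    (Finset.univ.filter fun j : Fin m => (j : ℕ) < n).card = n := by
  rw [Fin.card_filter_val_lt, min_eq_right h]

theorem eps_pos {m p q : ℕ} (j : Fin m) : 0 < (eps p q j : ℝ) ↔ (j : ℕ) < p := by
  unfold eps
  split_ifs with h1 h2
  · simp [h1]
  · refine iff_of_false ?_ h1
    norm_num
  · refine iff_of_false ?_ h1
    norm_num

theorem eps_neg {m p q : ℕ} (j : Fin m) :
    (eps p q j : ℝ) < 0 ↔ ¬ (j : ℕ) < p ∧ (j : ℕ) < p + q := by
  unfold eps
  split_ifs <;> simp_all [not_lt.2]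

theorem card_eps_pos {m p q : ℕ} (h : p + q ≤ m) :
    (Finset.univ.filter fun j : Fin m => 0 < eps p q j).card = p := by
  simp only [eps_pos]
  exact card_lt (by omega)

theorem card_eps_neg {m p q : ℕ} (h : p + q ≤ m) :
    (Finset.univ.filter fun j : Fin m => eps p q j < 0).card = q := by
  simp only [eps_neg]
  have h1 : (Finset.univ.filter fun j : Fin m => ¬ (j : ℕ) < p ∧ (j : ℕ) < p + q) =
      (Finset.univ.filter fun j : Fin m => (j : ℕ) < p + q) \
        (Finset.univ.filter fun j : Fin m => (j : ℕ) < p) := by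
    ext j
    simp only [Finset.mem_filter, Finset.mem_sdiff, Finset.mem_univ, true_and]
    tauto
  rw [h1, Finset.card_sdiff_of_subset, card_lt h, card_lt (by omega)]
  · omega
  · intro j
    simp only [Finset.mem_filter, Finset.mem_univ, true_and]
    omega

theorem exists_sort {m : ℕ} (l : Fin m → ℝ) : ∃ (σ : Equiv.Perm (Fin m)) (p q : ℕ), p + q ≤ m ∧
    ∀ j, eps p q j * Real.exp (Real.log |l (σ j)|) = l (σ j) := by
  let f : Fin m → ℕ := fun j => if 0 < l j then 0 else if l j < 0 then 1 else 2
  let σ := Tuple.sort f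
  have hmono : Monotone (f ∘ σ) := Tuple.monotone_sort f
  let P := (Finset.univ.filter fun i : Fin m => (f ∘ σ) i ≤ 0).card
  let Q := (Finset.univ.filter fun i : Fin m => (f ∘ σ) i ≤ 1).card
  have hP : ∀ j : Fin m, (j : ℕ) < P ↔ (f ∘ σ) j ≤ 0 := fun j => by
    have := Tuple.lt_card_le_iff_apply_le_of_monotone (j := j) (a := 0) hmono
    convert this
  have hQ : ∀ j : Fin m, (j : ℕ) < Q ↔ (f ∘ σ) j ≤ 1 := fun j => by
    have := Tuple.lt_card_le_iff_apply_le_of_monotone (j := j) (a := 1) hmono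
    convert this
  have hPQ : P ≤ Q := Finset.card_le_card (by
    intro j
    simp only [Finset.mem_filter, Finset.mem_univ, true_and]
    omega)
  have hQm : Q ≤ m := by
    have := Finset.card_le_univ (Finset.univ.filter fun i : Fin m => (f ∘ σ) i ≤ 1)
    rwa [Fintype.card_fin] at this
  refine ⟨σ, P, Q - P, by omega, fun j => ?_⟩
  have e : P + (Q - P) = Q := by omega
  unfold eps
  simp only [e, hP, hQ, Function.comp_apply, f]
  rcases lt_trichotomy (l (σ j)) 0 with h | h | h
  · have h' : ¬ 0 < l (σ j) := not_lt.2 h.le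
    rw [Real.exp_log (abs_pos.2 h.ne), abs_of_neg h]
    simp [h, h']
  · simp [h]
  · rw [Real.exp_log (abs_pos.2 h.ne'), abs_of_pos h]
    simp [h]

theorem frame_perm (A : EJA J) {m : ℕ} {d : Fin m → J} (hd : A.IsFrame d)
    (σ : Equiv.Perm (Fin m)) : A.IsFrame fun j => d (σ j) := by
  refine ⟨fun j => hd.1 _, fun i j h => hd.2.1 _ _ fun h' => h (σ.injective h'), ?_⟩
  rw [Equiv.sum_comp σ d]
  exact hd.2.2

theorem orbit_exists (A : EJA J) {m : ℕ} {c d : Fin m → J} (hc : A.IsFrame c) (hd : A.IsFrame d)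
    (l : Fin m → ℝ) : ∃ p q : ℕ, p + q ≤ m ∧ ∃ g ∈ A.Lgroup,
      (g : J →L[ℝ] J) (∑ j, eps p q j • c j) = ∑ j, l j • d j := by
  obtain ⟨σ, p, q, hpq, h⟩ := exists_sort l
  obtain ⟨k, hk, hkc⟩ := A.frame_conj hc (A.frame_perm hd σ)
  obtain ⟨g, hg, hgk⟩ := A.exp_mul_mem_Lgroup (∑ j, Real.log |l j| • d j) hk
  refine ⟨p, q, hpq, g, hg, ?_⟩
  have hd' : ∀ j, NormedSpace.exp (A.Lc (∑ j, Real.log |l j| • d j)) (d j) =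
      Real.exp (Real.log |l j|) • d j := by
    intro j
    refine exp_apply_eig _ ?_
    rw [Lc_apply, A.comm, A.frame_mul_sum hd]
  rw [hgk, map_sum, ← Equiv.sum_comp σ (fun j => l j • d j)]
  refine Finset.sum_congr rfl fun j _ => ?_
  rw [map_smul, mul_apply_eq_comp, hkc, hd', smul_smul, h]

end EJA

/-- Fix a Jordan frame `(c₁,…,c_r)` of `J` and, for `p,q ≥ 0` with
`p + q ≤ r`, set `e_{p,q} = Σ_{j<p} c_j − Σ_{p≤j<p+q} c_j`.  Then `J` is the disjoint
union of the orbits `L·e_{p,q}`: every `x ∈ J` lies in exactly one such orbit. -/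
theorem EJA.orbit_decomposition {J : Type} [NormedAddCommGroup J] [NormedSpace ℝ J]
    [FiniteDimensional ℝ J] (A : EJA J) (c : Fin A.rank → J) (hc : A.IsFrame c) (x : J) :
    ∃! pq : ℕ × ℕ, pq.1 + pq.2 ≤ A.rank ∧
      ∃ g ∈ A.Lgroup, (g : J →L[ℝ] J)
        (∑ j : Fin A.rank, (if (j : ℕ) < pq.1 then (1 : ℝ)
          else if (j : ℕ) < pq.1 + pq.2 then -1 else 0) • c j) = x := by
  obtain ⟨d, l, hd, hx⟩ := A.spectral x
  obtain ⟨p, q, hpq, g, hg, h⟩ := A.orbit_exists hc hd l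
  refine ⟨(p, q), ⟨hpq, g, hg, h.trans hx.symm⟩, ?_⟩
  rintro ⟨p', q'⟩ ⟨hpq', g', hg', h'⟩
  have h'' : (g' : J →L[ℝ] J) (∑ j, EJA.eps p' q' j • c j) = ∑ j, l j • d j := h'.trans hx
  have e1 := A.pos_card_eq hc hd _ l hg.1 h
  have e2 := A.pos_card_eq hc hd _ l hg'.1 h''
  have e3 := A.neg_card_eq hc hd _ l hg.1 h
  have e4 := A.neg_card_eq hc hd _ l hg'.1 h''
  rw [EJA.card_eps_pos hpq] at e1
  rw [EJA.card_eps_pos hpq'] at e2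
  rw [EJA.card_eps_neg hpq] at e3
  rw [EJA.card_eps_neg hpq'] at e4
  exact Prod.ext (e2.trans e1.symm) (e4.trans e3.symm)
end

section
/- Let c be an idempotent of J. For every x₁ ∈ J(c,1) and every x₀ ∈ J(c,0), one has det(x₁ + x₀) = det_c(x₁) · det_{e−c}(x₀), where det_c and det_{e−c} are the determinants of the Jordan subalgebras J(c,1) and J(c,0). -/
open scoped BigOperators Classical

namespace EJA

section Helpers

variable {J : Type} [NormedAddCommGroup J] [NormedSpace ℝ J] [FiniteDimensional ℝ J]

/-- Linearized Jordan identity. -/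
theorem jordan_lin (A : EJA J) (x y z : J) :
    (2 : ℝ) • A.mul (A.mul x z) (A.mul x y) + A.mul (A.mul x x) (A.mul z y)
      = A.mul z (A.mul (A.mul x x) y) + (2 : ℝ) • A.mul x (A.mul (A.mul x z) y) := by
  have e1 := A.jordan (x + z) y
  have e2 := A.jordan (x - z) y
  have e3 := A.jordan z y
  simp only [map_add, map_sub, LinearMap.add_apply, LinearMap.sub_apply, A.comm z x] at e1 e2
  have e4 : (2 : ℝ) • ((2 : ℝ) • A.mul (A.mul x z) (A.mul x y) + A.mul (A.mul x x) (A.mul z y))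
      = (2 : ℝ) • (A.mul z (A.mul (A.mul x x) y) + (2 : ℝ) • A.mul x (A.mul (A.mul x z) y)) := by
    linear_combination (norm := module) e1 - e2 - (2 : ℝ) • e3
  exact smul_right_injective J (two_ne_zero) e4

theorem peirce_one_mul (A : EJA J) {c z y : J} (hc : A.mul c c = c) (hz : A.mul c z = z)
    (hy : A.mul c y = y) : A.mul c (A.mul z y) = A.mul z y := by
  have h := A.jordan_lin c y z
  rw [hc, hz, hy] at h
  linear_combination (norm := module) -h

theorem peirce_one_zero (A : EJA J) {c z y : J} (hc : A.mul c c = c) (hz : A.mul c z = z)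
    (hy : A.mul c y = 0) : A.mul z y = 0 := by
  have h := A.jordan_lin c y z
  have h' := A.jordan_lin c z y
  rw [hc, hz, hy] at h h'
  simp only [map_zero, LinearMap.zero_apply, smul_zero, zero_add, add_zero] at h h'
  rw [A.comm y z] at h'
  rw [← h']
  linear_combination (norm := module) -h

/-- Product of an element of an orthogonal family with a combination. -/
theorem mul_sum_orth (A : EJA J) {ι : Type} [Fintype ι] (d : ι → J)
    (hd : ∀ j, A.mul (d j) (d j) = d j) (ho : ∀ i j, i ≠ j → A.mul (d i) (d j) = 0)
    (a : ι → ℝ) (i : ι) : A.mul (d i) (∑ j, a j • d j) = a i • d i := by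
  rw [map_sum, Finset.sum_eq_single i]
  · rw [map_smul, hd]
  · intro j _ hj
    rw [map_smul, ho i j (Ne.symm hj), smul_zero]
  · simp

theorem sum_mul_sum_orth (A : EJA J) {ι : Type} [Fintype ι] (d : ι → J)
    (hd : ∀ j, A.mul (d j) (d j) = d j) (ho : ∀ i j, i ≠ j → A.mul (d i) (d j) = 0)
    (a b : ι → ℝ) : A.mul (∑ j, b j • d j) (∑ j, a j • d j) = ∑ j, (b j * a j) • d j := by
  rw [map_sum A.mul, LinearMap.sum_apply]
  refine Finset.sum_congr rfl fun i _ => ?_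
  rw [map_smul, LinearMap.smul_apply, A.mul_sum_orth d hd ho, smul_smul]

/-- Sum restricted to the support. -/
theorem sum_support {ι : Type} [Fintype ι] (l : ι → ℝ) (d : ι → J) (b : ι → ℝ)
    (hb : ∀ j, l j = 0 → b j = 0) :
    ∑ j : {j // l j ≠ 0}, b j • d j = ∑ j, b j • d j := by
  rw [← Finset.sum_subtype (Finset.univ.filter fun j => l j ≠ 0) (by simp)
    (fun j => b j • d j), Finset.sum_filter]
  refine Finset.sum_congr rfl fun j _ => ?_
  by_cases h : l j = 0
  · simp [h, hb j h]
  · simp [h]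

/-- Every idempotent is a sum of orthogonal primitive idempotents. -/
theorem idem_decomp (A : EJA J) {f : J} (hf : A.mul f f = f) :
    ∃ (ι : Type) (_ : Fintype ι) (d : ι → J), (∀ j, A.IsPrimitive (d j)) ∧
      (∀ i j, i ≠ j → A.mul (d i) (d j) = 0) ∧ ∑ j, d j = f := by
  obtain ⟨d, mu, ⟨hp, ho, -⟩, hx⟩ := A.spectral f
  have hd : ∀ j, A.mul (d j) (d j) = d j := fun j => (hp j).1
  have hmu : ∀ j, mu j ≠ 0 → mu j = 1 := by
    intro j hj
    have h1 : A.mul (d j) f = mu j • d j := by rw [hx]; exact A.mul_sum_orth d hd ho mu j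
    have h2 : A.mul (d j) f = (mu j * mu j) • d j := by
      rw [← hf, hx, A.sum_mul_sum_orth d hd ho]; exact A.mul_sum_orth d hd ho _ j
    have h3 := smul_left_injective ℝ (hp j).2.1 (h1.symm.trans h2)
    have h4 : mu j * (mu j - 1) = 0 := by linear_combination -h3
    rcases mul_eq_zero.1 h4 with h | h
    · exact absurd h hj
    · linarith
  refine ⟨{j // mu j ≠ 0}, inferInstance, fun j => d j, fun j => hp j,
    fun i j hij => ho i j (fun h => hij (Subtype.ext h)), ?_⟩
  rw [hx, ← sum_support mu d mu (fun _ h => h)]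
  refine Finset.sum_congr rfl fun j _ => ?_
  rw [hmu j j.2, one_smul]

/-- Members of an orthogonal idempotent family lie in the Peirce one space of the sum. -/
theorem sum_mul_mem (A : EJA J) {ι : Type} [Fintype ι] (d : ι → J)
    (hp : ∀ j, A.IsPrimitive (d j)) (ho : ∀ i j, i ≠ j → A.mul (d i) (d j) = 0) {c : J}
    (hs : ∑ j, d j = c) (i : ι) : A.mul c (d i) = d i := by
  have h := A.mul_sum_orth d (fun j => (hp j).1) ho (fun _ => 1) i
  simp only [one_smul] at h
  rw [A.comm, ← hs, h]

/-- Spectral theorem in the Peirce one space. -/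
theorem spectral_peirce (A : EJA J) {c x : J} (hc : A.mul c c = c) (hx : A.mul c x = x) :
    ∃ (ι : Type) (_ : Fintype ι) (d : ι → J) (lam : ι → ℝ), (∀ j, A.IsPrimitive (d j)) ∧
      (∀ i j, i ≠ j → A.mul (d i) (d j) = 0) ∧ ∑ j, d j = c ∧ ∑ j, lam j • d j = x := by
  obtain ⟨d, lam, ⟨hp, ho, -⟩, hxs⟩ := A.spectral x
  have hd : ∀ j, A.mul (d j) (d j) = d j := fun j => (hp j).1
  have hpow : ∀ n : ℕ, A.mul c (∑ j, (lam j ^ (n + 1)) • d j) = ∑ j, (lam j ^ (n + 1)) • d j := by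
    intro n
    induction n with
    | zero => simpa [← hxs] using hx
    | succ n ih =>
      have h := A.peirce_one_mul hc hx ih
      rw [hxs, A.sum_mul_sum_orth d hd ho] at h
      simpa only [pow_succ' _ (n + 1)] using h
  have hpoly : ∀ q : Polynomial ℝ, A.mul c (∑ j, (lam j * q.eval (lam j)) • d j)
      = ∑ j, (lam j * q.eval (lam j)) • d j := by
    intro q
    induction q using Polynomial.induction_on' with
    | add p q h1 h2 =>
      simp only [Polynomial.eval_add, mul_add, add_smul, Finset.sum_add_distrib, map_add, h1, h2]
    | monomial n a =>
      have e : ∀ j, (lam j * (Polynomial.monomial n a).eval (lam j)) • d j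
          = a • ((lam j ^ (n + 1)) • d j) := by
        intro j
        rw [Polynomial.eval_monomial, smul_smul]; congr 1; ring
      simp only [e, ← Finset.smul_sum, map_smul, hpow n]
  set p : J := ∑ j : {j // lam j ≠ 0}, d j with hpdef
  have hcp : A.mul c p = p := by
    have h := hpoly (Lagrange.interpolate (Finset.univ.image lam) id (fun t => t⁻¹))
    have e : p = ∑ j, (lam j * (Lagrange.interpolate (Finset.univ.image lam) id
        (fun t => t⁻¹)).eval (lam j)) • d j := by
      rw [← sum_support lam d _ (fun j hj => by rw [hj, zero_mul])]
      refine Finset.sum_congr rfl fun j _ => ?_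
      have := Lagrange.eval_interpolate_at_node (s := Finset.univ.image lam) (v := id)
        (i := lam j) (fun t : ℝ => t⁻¹) (Set.injOn_id _) (by simp)
      simp only [id] at this
      erw [this]
      rw [mul_inv_cancel₀ j.2, one_smul]
    rw [← e] at h
    exact h
  have hpd : ∀ j : {j // lam j ≠ 0}, A.mul p (d j) = d j :=
    A.sum_mul_mem (fun j : {j // lam j ≠ 0} => d j) (fun j => hp j)
      (fun i j hij => ho i j (fun h => hij (Subtype.ext h))) rfl
  have hpp : A.mul p p = p := by
    have h : A.mul p (∑ j : {j // lam j ≠ 0}, d j) = ∑ j : {j // lam j ≠ 0}, d j := by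
      rw [map_sum]
      exact Finset.sum_congr rfl fun j _ => hpd j
    exact h
  have hpc : A.mul p c = p := by rw [A.comm]; exact hcp
  have hff : A.mul (c - p) (c - p) = c - p := by
    simp only [map_sub, LinearMap.sub_apply, hc, hcp, hpc, hpp]; abel
  have hpf : A.mul p (c - p) = 0 := by rw [map_sub, hpc, hpp, sub_self]
  obtain ⟨κ, _, g, gp, go, gs⟩ := A.idem_decomp hff
  have hfg : ∀ k, A.mul (c - p) (g k) = g k := A.sum_mul_mem g gp go gs
  have hfd : ∀ j : {j // lam j ≠ 0}, A.mul (c - p) (d j) = 0 := by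
    intro j
    rw [A.comm]
    exact A.peirce_one_zero hpp (hpd j) hpf
  have hgd : ∀ k (j : {j // lam j ≠ 0}), A.mul (g k) (d j) = 0 := fun k j =>
    A.peirce_one_zero hff (hfg k) (hfd j)
  refine ⟨{j // lam j ≠ 0} ⊕ κ, inferInstance, Sum.elim (fun j => d j) g,
    Sum.elim (fun j => lam j) (fun _ => 0), ?_, ?_, ?_, ?_⟩
  · rintro (j | k)
    · exact hp j
    · exact gp k
  · rintro (i | i) (j | j) hij
    · exact ho i j (fun h => hij (by rw [Subtype.ext h]))
    · simp only [Sum.elim_inl, Sum.elim_inr]; rw [A.comm]; exact hgd j i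
    · exact hgd i j
    · exact go i j (fun h => hij (by rw [h]))
  · rw [Fintype.sum_sum_type]
    simp only [Sum.elim_inl, Sum.elim_inr]
    rw [gs, ← hpdef]; abel
  · rw [Fintype.sum_sum_type]
    simp only [Sum.elim_inl, Sum.elim_inr, zero_smul, Finset.sum_const_zero, add_zero]
    rw [sum_support lam d lam (fun _ h => h), ← hxs]

/-- Transfer of a determinant characterization from `Fin m` to a finite type. -/
theorem det_transfer (A : EJA J) (c : J) (D : J → ℝ)
    (hD : ∀ (m : ℕ) (d : Fin m → J) (lam : Fin m → ℝ),
      (∀ j, A.IsPrimitive (d j)) → (∀ i j, i ≠ j → A.mul (d i) (d j) = 0) →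
      (∑ j, d j = c) → D (∑ j, lam j • d j) = ∏ j, lam j)
    {ι : Type} [Fintype ι] (d : ι → J) (lam : ι → ℝ) (hp : ∀ j, A.IsPrimitive (d j))
    (ho : ∀ i j, i ≠ j → A.mul (d i) (d j) = 0) (hs : ∑ j, d j = c) :
    D (∑ j, lam j • d j) = ∏ j, lam j := by
  let E := (Fintype.equivFin ι).symm
  have h := hD _ (d ∘ E) (lam ∘ E) (fun j => hp _)
    (fun i j hij => ho _ _ (fun h => hij (E.injective h)))
    ((Equiv.sum_comp E d).trans hs)
  simp only [Function.comp_apply] at h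
  rwa [Equiv.sum_comp E (fun j => lam j • d j), Equiv.prod_comp E lam] at h

/-- The number of elements of a complete orthogonal system of primitives is the rank. -/
theorem card_eq_rank (A : EJA J) {ι : Type} [Fintype ι] (d : ι → J)
    (hp : ∀ j, A.IsPrimitive (d j)) (hs : ∑ j, d j = A.e) : Fintype.card ι = A.rank := by
  obtain ⟨f, -, ⟨fp, -, fs⟩, -⟩ := A.spectral 0
  have h1 : A.tr A.e = Fintype.card ι := by
    rw [← hs, map_sum, Finset.sum_congr rfl (fun j _ => A.tr_prim _ (hp j))]; simp
  have h2 : A.tr A.e = A.rank := by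
    rw [← fs, map_sum, Finset.sum_congr rfl (fun j _ => A.tr_prim _ (fp j))]; simp
  exact_mod_cast h1.symm.trans h2

end Helpers

end EJA

/-- Let `c` be an idempotent of `J`.  For every `x₁ ∈ J(c,1)` and every
`x₀ ∈ J(c,0)`, `det(x₁ + x₀) = det_c(x₁) · det_{e−c}(x₀)`.  Here `det_c` and `det_{e−c}`,
the determinants of the Jordan subalgebras `J(c,1)` and `J(c,0)`, are characterized by
their values on spectral decompositions relative to Jordan frames of these subalgebras
(systems of pairwise orthogonal primitive idempotents summing to `c`, resp. to `e − c`). -/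
theorem EJA.jdet_add_of_peirce {J : Type} [NormedAddCommGroup J] [NormedSpace ℝ J]
    [FiniteDimensional ℝ J] (A : EJA J) (c : J) (hc : A.IsIdem c)
    (detc det0 : J → ℝ)
    (hdetc : ∀ (m : ℕ) (d : Fin m → J) (lam : Fin m → ℝ),
      (∀ j, A.IsPrimitive (d j)) → (∀ i j, i ≠ j → A.mul (d i) (d j) = 0) →
      (∑ j, d j = c) → detc (∑ j, lam j • d j) = ∏ j, lam j)
    (hdet0 : ∀ (m : ℕ) (d : Fin m → J) (lam : Fin m → ℝ),
      (∀ j, A.IsPrimitive (d j)) → (∀ i j, i ≠ j → A.mul (d i) (d j) = 0) →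
      (∑ j, d j = A.e - c) → det0 (∑ j, lam j • d j) = ∏ j, lam j)
    (x1 x0 : J) (h1 : x1 ∈ A.peirce c 1) (h0 : x0 ∈ A.peirce c 0) :
    A.jdet (x1 + x0) = detc x1 * det0 x0 := by
  have hc' : A.mul c c = c := hc
  have h1' : A.mul c x1 = x1 := by
    have h := h1
    simp only [EJA.peirce, LinearMap.mem_ker, LinearMap.sub_apply, LinearMap.smul_apply,
      LinearMap.id_apply, one_smul] at h
    exact sub_eq_zero.1 h
  have h0' : A.mul c x0 = 0 := by
    have h := h0
    simp only [EJA.peirce, LinearMap.mem_ker, LinearMap.sub_apply, LinearMap.smul_apply,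
      zero_smul, sub_zero] at h
    exact h
  have hce : A.mul c A.e = c := by rw [A.comm, A.unit_mul]
  have hb : A.mul (A.e - c) (A.e - c) = A.e - c := by
    simp only [map_sub, LinearMap.sub_apply, A.unit_mul, hce, hc']; abel
  have hbx : A.mul (A.e - c) x0 = x0 := by
    rw [map_sub, LinearMap.sub_apply, A.unit_mul, h0', sub_zero]
  obtain ⟨ι, _, d, lam, dp, dor, ds, dx⟩ := A.spectral_peirce hc' h1'
  obtain ⟨κ, _, g, mu, gp, gor, gs, gx⟩ := A.spectral_peirce hb hbx
  have hdg : ∀ i k, A.mul (d i) (g k) = 0 := by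
    intro i k
    refine A.peirce_one_zero hc' (A.sum_mul_mem d dp dor ds i) ?_
    have h := A.sum_mul_mem g gp gor gs k
    rw [map_sub, LinearMap.sub_apply, A.unit_mul] at h
    exact sub_eq_self.1 h
  have e1 := A.det_transfer c detc hdetc d lam dp dor ds
  have e2 := A.det_transfer (A.e - c) det0 hdet0 g mu gp gor gs
  rw [dx] at e1
  rw [gx] at e2
  rw [e1, e2]
  let F : ι ⊕ κ → J := Sum.elim d g
  let M : ι ⊕ κ → ℝ := Sum.elim lam mu
  have Fp : ∀ j, A.IsPrimitive (F j) := by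
    rintro (j | k)
    · exact dp j
    · exact gp k
  have Fo : ∀ i j, i ≠ j → A.mul (F i) (F j) = 0 := by
    rintro (i | i) (j | j) hij
    · exact dor i j (fun h => hij (by rw [h]))
    · exact hdg i j
    · exact (A.comm _ _).trans (hdg j i)
    · exact gor i j (fun h => hij (by rw [h]))
  have Fs : ∑ j, F j = A.e := by
    rw [Fintype.sum_sum_type]
    simp only [F, Sum.elim_inl, Sum.elim_inr]
    rw [ds, gs]; abel
  have Fx : ∑ j, M j • F j = x1 + x0 := by
    rw [Fintype.sum_sum_type]
    simp only [F, M, Sum.elim_inl, Sum.elim_inr]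
    rw [dx, gx]
  have FM : ∏ j, M j = (∏ j, lam j) * ∏ j, mu j := by
    rw [Fintype.prod_sum_type]
    simp only [M, Sum.elim_inl, Sum.elim_inr]
  let E : Fin A.rank ≃ ι ⊕ κ := (Fintype.equivFinOfCardEq (A.card_eq_rank F Fp Fs)).symm
  have h := A.jdet_frame (F ∘ E) (M ∘ E) ⟨fun j => Fp _,
    fun i j hij => Fo _ _ (fun h => hij (E.injective h)), (Equiv.sum_comp E F).trans Fs⟩
  simp only [Function.comp_apply] at h
  rw [Equiv.sum_comp E (fun j => M j • F j), Equiv.prod_comp E M, Fx, FM] at h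
  exact h
end
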